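/- arXiv:0904.3526 — 2 statements merged into one kernel-verified Lean document; each statement's English description precedes it below -/
import Mathlib

section
/- Let N be a sufficiently large integer, n an integer with 3 ≤ n ≤ N, and r a positive integer with r < N^{1 - 1/(20 \log L)}, where L = log N. Then the number of primes q ≤ N/r such that both rq + 1 and n - 1 - rq are prime is \ll (N/r) L^{-3} (\log L)^6, where the implied constant is absolute. -/
open Finset

noncomputable section

open scoped ArithmeticFunction.Moebius

/-- The completely multiplicative function with prescribed values at the primes. -/
noncomputable def completelyMultiplicative (x : ℕ → ℝ) : ℕ →* ℝ where
  toFun n := if n = 0 then 0 else n.factorization.prod fun p k => x p ^ k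
  map_one' := by simp
  map_mul' m n := by
    by_cases hm : m = 0
    · simp [hm]
    by_cases hn : n = 0
    · simp [hn]
    simp only [hm, hn, mul_eq_zero, or_self, if_false]
    rw [Nat.factorization_mul hm hn]
    exact Finsupp.prod_add_index' (by simp) (fun p a b => pow_add _ _ _)

theorem completelyMultiplicative_prime (x : ℕ → ℝ) {p : ℕ} (hp : p.Prime) :
    completelyMultiplicative x p = x p := by
  simp [completelyMultiplicative, hp.ne_zero, hp.factorization]

theorem completelyMultiplicative_nonneg {x : ℕ → ℝ} (hx : ∀ p, 0 ≤ x p) (n : ℕ) :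
    0 ≤ completelyMultiplicative x n := by
  simp only [completelyMultiplicative, MonoidHom.coe_mk, OneHom.coe_mk]
  split_ifs
  · rfl
  · exact Finset.prod_nonneg fun p _ => pow_nonneg (hx p) _

theorem sum_divisorsAntidiagonal_le {f g h : ℕ →* ℝ} (hf : ∀ n, 0 ≤ f n) (hg : ∀ n, 0 ≤ g n)
    (hfg : ∀ p : ℕ, p.Prime → f p + g p ≤ h p) {m : ℕ} (hm : m ≠ 0) :
    ∑ x ∈ m.divisorsAntidiagonal, f x.1 * g x.2 ≤ h m := by
  induction m using induction_on_primes with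
  | zero => exact absurd rfl hm
  | one => simp
  | prime_mul p n hp ih =>
    have hn : n ≠ 0 := right_ne_zero_of_mul hm
    have key : ∑ x ∈ (p * n).divisorsAntidiagonal, f x.1 * g x.2 ≤
        ∑ x ∈ n.divisorsAntidiagonal, f (p * x.1) * g x.2 +
          ∑ x ∈ n.divisorsAntidiagonal, f x.1 * g (p * x.2) := by
      have hsub : (p * n).divisorsAntidiagonal ⊆
          n.divisorsAntidiagonal.image (fun x => (p * x.1, x.2)) ∪
          n.divisorsAntidiagonal.image (fun x => (x.1, p * x.2)) := by
        rintro ⟨a, b⟩ hab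
        rw [Nat.mem_divisorsAntidiagonal] at hab
        obtain ⟨hab, -⟩ := hab
        dsimp only at hab
        rw [mem_union, mem_image, mem_image]
        rcases (hp.dvd_mul).1 (Dvd.intro n hab.symm) with ⟨c, rfl⟩ | ⟨c, rfl⟩
        · left
          refine ⟨(c, b), ?_, rfl⟩
          rw [Nat.mem_divisorsAntidiagonal]
          refine ⟨?_, hn⟩
          rw [mul_assoc] at hab
          exact Nat.eq_of_mul_eq_mul_left hp.pos hab
        · right
          refine ⟨(a, c), ?_, rfl⟩
          rw [Nat.mem_divisorsAntidiagonal]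
          refine ⟨?_, hn⟩
          rw [mul_left_comm] at hab
          exact Nat.eq_of_mul_eq_mul_left hp.pos hab
      have hnn : ∀ x : ℕ × ℕ, 0 ≤ f x.1 * g x.2 := fun x => mul_nonneg (hf _) (hg _)
      refine (sum_le_sum_of_subset_of_nonneg hsub fun x _ _ => hnn x).trans ?_
      refine (le_of_le_of_eq (le_add_of_nonneg_right (sum_nonneg fun x _ => hnn x))
        sum_union_inter).trans ?_
      gcongr
      · exact sum_image_le_of_nonneg (fun x _ => hnn _)
      · exact sum_image_le_of_nonneg (fun x _ => hnn _)
    refine key.trans ?_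
    have e : ∑ x ∈ n.divisorsAntidiagonal, f (p * x.1) * g x.2 +
          ∑ x ∈ n.divisorsAntidiagonal, f x.1 * g (p * x.2) =
        (f p + g p) * ∑ x ∈ n.divisorsAntidiagonal, f x.1 * g x.2 := by
      rw [add_mul, mul_sum, mul_sum]
      simp only [map_mul]
      congr 1 <;> exact sum_congr rfl fun x _ => by ring
    rw [e, map_mul]
    exact mul_le_mul (hfg p hp) (ih hn) (sum_nonneg fun x _ => mul_nonneg (hf _) (hg _))
      ((add_nonneg (hf p) (hg p)).trans (hfg p hp))

theorem sum_mul_sum_le_sum {f g h : ℕ →* ℝ} (hf : ∀ n, 0 ≤ f n) (hg : ∀ n, 0 ≤ g n)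
    (hfg : ∀ p : ℕ, p.Prime → f p + g p ≤ h p) (a b : ℕ) :
    (∑ m ∈ Icc 1 a, f m) * ∑ m ∈ Icc 1 b, g m ≤ ∑ m ∈ Icc 1 (a * b), h m := by
  calc (∑ m ∈ Icc 1 a, f m) * ∑ m ∈ Icc 1 b, g m
      = ∑ x ∈ Icc 1 a ×ˢ Icc 1 b, f x.1 * g x.2 := by rw [sum_mul_sum, sum_product]
    _ = ∑ m ∈ Icc 1 (a * b), ∑ x ∈ Icc 1 a ×ˢ Icc 1 b with x.1 * x.2 = m, f x.1 * g x.2 := by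
        refine (sum_fiberwise_of_maps_to (fun x hx => ?_) _).symm
        rw [mem_product, mem_Icc, mem_Icc] at hx
        rw [mem_Icc]
        exact ⟨Nat.mul_pos hx.1.1 hx.2.1, Nat.mul_le_mul hx.1.2 hx.2.2⟩
    _ ≤ ∑ m ∈ Icc 1 (a * b), h m := by
        refine sum_le_sum fun m hm => ?_
        rw [mem_Icc] at hm
        have hm0 : m ≠ 0 := by omega
        refine le_trans (sum_le_sum_of_subset_of_nonneg (fun x hx => ?_)
          fun x _ _ => mul_nonneg (hf _) (hg _)) (sum_divisorsAntidiagonal_le hf hg hfg hm0)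
        rw [mem_filter] at hx
        exact Nat.mem_divisorsAntidiagonal.2 ⟨hx.2, hm0⟩

/-- Every positive integer splits as a product on which the two functions reproduce `h`. -/
theorem exists_mul_eq_and_le {f g h : ℕ →* ℝ} (hf : ∀ n, 0 ≤ f n) (hg : ∀ n, 0 ≤ g n)
    (hh : ∀ n, 0 ≤ h n) (hfg : ∀ p : ℕ, p.Prime → h p ≤ f p ∨ h p ≤ g p) {m : ℕ} (hm : m ≠ 0) :
    ∃ a b, a * b = m ∧ h m ≤ f a * g b := by
  induction m using induction_on_primes with
  | zero => exact absurd rfl hm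
  | one => exact ⟨1, 1, by simp, by simp⟩
  | prime_mul p n hp ih =>
    obtain ⟨a, b, hab, hle⟩ := ih (right_ne_zero_of_mul hm)
    rcases hfg p hp with hp' | hp'
    · refine ⟨p * a, b, by rw [mul_assoc, hab], ?_⟩
      rw [map_mul, map_mul, mul_assoc]
      exact mul_le_mul hp' hle (hh _) (hf _)
    · refine ⟨a, p * b, by rw [mul_left_comm, hab], ?_⟩
      rw [map_mul, map_mul, mul_left_comm]
      exact mul_le_mul hp' hle (hh _) (hg _)

theorem sum_le_sum_mul_sum {f g h : ℕ →* ℝ} (hf : ∀ n, 0 ≤ f n) (hg : ∀ n, 0 ≤ g n)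
    (hh : ∀ n, 0 ≤ h n) (hfg : ∀ p : ℕ, p.Prime → h p ≤ f p ∨ h p ≤ g p) (y : ℕ) :
    ∑ m ∈ Icc 1 y, h m ≤ (∑ m ∈ Icc 1 y, f m) * ∑ m ∈ Icc 1 y, g m := by
  have hex : ∀ m : ℕ, ∃ x : ℕ × ℕ, m ≠ 0 → x.1 * x.2 = m ∧ h m ≤ f x.1 * g x.2 := by
    intro m
    by_cases hm : m = 0
    · exact ⟨(0, 0), fun h => absurd hm h⟩
    · obtain ⟨a, b, hab⟩ := exists_mul_eq_and_le hf hg hh hfg hm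
      exact ⟨(a, b), fun _ => hab⟩
  choose x hx using hex
  have hne : ∀ m ∈ Icc 1 y, m ≠ 0 := fun m hm => by rw [mem_Icc] at hm; omega
  calc ∑ m ∈ Icc 1 y, h m ≤ ∑ m ∈ Icc 1 y, f (x m).1 * g (x m).2 :=
        sum_le_sum fun m hm => (hx m (hne m hm)).2
    _ = ∑ c ∈ (Icc 1 y).image x, f c.1 * g c.2 := by
        rw [sum_image]
        intro m hm m' hm' hmm
        rw [← (hx m (hne m hm)).1, ← (hx m' (hne m' hm')).1, hmm]
    _ ≤ ∑ c ∈ Icc 1 y ×ˢ Icc 1 y, f c.1 * g c.2 := by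
        refine sum_le_sum_of_subset_of_nonneg (fun c hc => ?_)
          fun c _ _ => mul_nonneg (hf _) (hg _)
        obtain ⟨m, hm, rfl⟩ := mem_image.1 hc
        have h1 := (hx m (hne m hm)).1
        have h2 := hne m hm
        rw [mem_Icc] at hm
        rw [← h1] at h2
        rw [mem_product, mem_Icc, mem_Icc]
        have ha := Nat.pos_of_ne_zero (left_ne_zero_of_mul h2)
        have hb := Nat.pos_of_ne_zero (right_ne_zero_of_mul h2)
        refine ⟨⟨ha, ?_⟩, hb, ?_⟩
        · exact (Nat.le_mul_of_pos_right _ hb).trans (h1.le.trans hm.2)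
        · exact (Nat.le_mul_of_pos_left _ ha).trans (h1.le.trans hm.2)
    _ = _ := by rw [sum_mul_sum, sum_product]

theorem sum_completelyMultiplicative_le_prod {x : ℕ → ℝ} (hx : ∀ p, 0 ≤ x p)
    (hx1 : ∀ p : ℕ, p.Prime → x p < 1) (S T : Finset ℕ) (hT : ∀ m ∈ T, m ∈ Nat.factoredNumbers S) :
    ∑ m ∈ T, completelyMultiplicative x m ≤ ∏ p ∈ S with p.Prime, (1 - x p)⁻¹ := by
  have hn := fun m => completelyMultiplicative_nonneg hx m
  have h := EulerProduct.summable_and_hasSum_factoredNumbers_prod_filter_prime_geometric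
    (f := completelyMultiplicative x) (fun {p} hp => by
      rw [Real.norm_of_nonneg (hn p), completelyMultiplicative_prime x hp]; exact hx1 p hp) S
  have e : ∏ p ∈ S with p.Prime, (1 - completelyMultiplicative x p)⁻¹ =
      ∏ p ∈ S with p.Prime, (1 - x p)⁻¹ := prod_congr rfl fun p hp => by
    rw [completelyMultiplicative_prime x (mem_filter.1 hp).2]
  rw [← e]
  have := sum_le_hasSum (T.subtype (· ∈ Nat.factoredNumbers S)) (fun i _ => hn i) h.2
  refine le_trans (le_of_eq ?_) this
  exact (Finset.sum_subtype_of_mem (fun m => completelyMultiplicative x m) hT).symm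

theorem sum_filter_dvd_moebius {l m : ℕ} (hm : Squarefree m) (hl : l ∣ m) :
    ∑ d ∈ m.divisors with l ∣ d, (μ d : ℝ) = if l = m then (μ l : ℝ) else 0 := by
  obtain ⟨k, rfl⟩ := hl
  have hlk := Squarefree.ne_zero hm
  have hl0 := left_ne_zero_of_mul hlk
  have hk0 := right_ne_zero_of_mul hlk
  have hcop : l.Coprime k := Nat.coprime_of_squarefree_mul hm
  have e : (l * k).divisors.filter (l ∣ ·) = k.divisors.image (l * ·) := by
    ext d
    simp only [mem_filter, Nat.mem_divisors, mem_image]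
    constructor
    · rintro ⟨⟨h1, -⟩, c, rfl⟩
      exact ⟨c, ⟨Nat.dvd_of_mul_dvd_mul_left (Nat.pos_of_ne_zero hl0) h1, hk0⟩, rfl⟩
    · rintro ⟨c, ⟨hc, -⟩, rfl⟩
      exact ⟨⟨mul_dvd_mul_left l hc, hlk⟩, dvd_mul_right _ _⟩
  rw [e, sum_image fun a _ b _ h => Nat.eq_of_mul_eq_mul_left (Nat.pos_of_ne_zero hl0) h]
  have h2 : ∀ c ∈ k.divisors, ((μ (l * c) : ℤ) : ℝ) = μ l * μ c := fun c hc => by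
    rw [ArithmeticFunction.isMultiplicative_moebius.map_mul_of_coprime
      (hcop.coprime_dvd_right (Nat.dvd_of_mem_divisors hc))]
    push_cast; rfl
  rw [sum_congr rfl h2, ← mul_sum]
  have h3 : (∑ c ∈ k.divisors, (μ c : ℝ)) = if k = 1 then 1 else 0 := by
    have := DFunLike.congr_fun (ArithmeticFunction.coe_moebius_mul_coe_zeta (R := ℝ)) k
    rw [ArithmeticFunction.coe_mul_zeta_apply, ArithmeticFunction.one_apply] at this
    exact this
  rw [h3]
  by_cases hk : k = 1
  · simp [hk]
  · have : l ≠ l * k := fun h => hk (by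
      have := Nat.eq_of_mul_eq_mul_left (Nat.pos_of_ne_zero hl0) ((mul_one l).trans h)
      exact this.symm)
    simp [hk, this]

namespace BoundingSieve

variable (s : BoundingSieve) (z : ℕ)

/-- The denominator in the main term of Selberg's upper bound. -/
noncomputable def selbergSum : ℝ := ∑ m ∈ s.prodPrimes.divisors with m ≤ z, s.selbergTerms m

/-- Selberg's optimal weights, supported on integers up to `z`. -/
noncomputable def selbergWeight (d : ℕ) : ℝ :=
  μ d * (s.nu d)⁻¹ * (s.selbergSum z)⁻¹ *
    ∑ m ∈ s.prodPrimes.divisors with m ≤ z ∧ d ∣ m, s.selbergTerms m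

variable {s z}

theorem selbergSum_pos (hz : 1 ≤ z) : 0 < s.selbergSum z := by
  refine sum_pos (fun m hm => selbergTerms_pos (Nat.dvd_of_mem_divisors (mem_filter.1 hm).1)) ⟨1, ?_⟩
  simp [hz, prodPrimes_ne_zero]

theorem selbergWeight_one (hz : 1 ≤ z) : s.selbergWeight z 1 = 1 := by
  have := (s.selbergSum_pos hz).ne'
  simp only [selbergWeight, one_dvd, and_true, s.nu_mult.map_one]
  rw [← selbergSum]
  simp [this]

theorem sum_nu_mul_selbergWeight {l : ℕ} (hl : l ∣ s.prodPrimes) :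
    (∑ d ∈ s.prodPrimes.divisors, if l ∣ d then s.nu d * s.selbergWeight z d else 0) =
      if l ≤ z then (s.selbergSum z)⁻¹ * μ l * s.selbergTerms l else 0 := by
  calc (∑ d ∈ s.prodPrimes.divisors, if l ∣ d then s.nu d * s.selbergWeight z d else 0)
      = ∑ d ∈ s.prodPrimes.divisors, ∑ m ∈ s.prodPrimes.divisors,
          if l ∣ d ∧ m ≤ z ∧ d ∣ m then (s.selbergSum z)⁻¹ * s.selbergTerms m * μ d else 0 := by
        refine sum_congr rfl fun d hd => ?_
        have hnu := nu_ne_zero (Nat.dvd_of_mem_divisors hd)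
        by_cases h : l ∣ d
        · simp only [h, if_true, true_and, selbergWeight, sum_filter]
          rw [mul_sum, mul_sum]
          refine sum_congr rfl fun m _ => ?_
          split_ifs
          · field_simp
          · simp
        · simp [h]
    _ = ∑ m ∈ s.prodPrimes.divisors, ∑ d ∈ s.prodPrimes.divisors,
          if l ∣ d ∧ m ≤ z ∧ d ∣ m then (s.selbergSum z)⁻¹ * s.selbergTerms m * μ d else 0 :=
        sum_comm
    _ = ∑ m ∈ s.prodPrimes.divisors, if m = l then
          (if l ≤ z then (s.selbergSum z)⁻¹ * μ l * s.selbergTerms l else 0) else 0 := by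
        refine sum_congr rfl fun m hm => ?_
        have hmP := Nat.dvd_of_mem_divisors hm
        by_cases hmz : m ≤ z
        · have e : (∑ d ∈ s.prodPrimes.divisors,
              if l ∣ d ∧ m ≤ z ∧ d ∣ m then (s.selbergSum z)⁻¹ * s.selbergTerms m * μ d else 0) =
              (s.selbergSum z)⁻¹ * s.selbergTerms m * ∑ d ∈ m.divisors with l ∣ d, (μ d : ℝ) := by
            rw [mul_sum, ← Nat.divisors_filter_dvd_of_dvd prodPrimes_ne_zero hmP, filter_filter,
              sum_filter]
            refine sum_congr rfl fun d _ => ?_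
            simp only [hmz, true_and]
            congr 1
            exact propext and_comm
          rw [e]
          by_cases hlm : l ∣ m
          · rw [sum_filter_dvd_moebius (squarefree_of_dvd_prodPrimes hmP) hlm]
            by_cases h : l = m
            · subst h
              simp only [hmz, if_true]
              ring
            · simp [h, Ne.symm h]
          · have hne : m ≠ l := fun h => hlm (h ▸ dvd_rfl)
            rw [if_neg hne, sum_eq_zero, mul_zero]
            intro d hd
            rw [mem_filter] at hd
            exact absurd (hd.2.trans (Nat.dvd_of_mem_divisors hd.1)) hlm
        · have : m = l → ¬ l ≤ z := fun h => h ▸ hmz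
          simp only [hmz, false_and, and_false, if_false, sum_const_zero]
          split_ifs with h1 h2
          · exact absurd h2 (this h1)
          · rfl
          · rfl
    _ = _ := by
        rw [sum_ite_eq' _ l, if_pos (Nat.mem_divisors.2 ⟨hl, prodPrimes_ne_zero⟩)]

theorem mainSum_selbergWeight (hz : 1 ≤ z) :
    s.mainSum (lambdaSquared (s.selbergWeight z)) = (s.selbergSum z)⁻¹ := by
  have hG := (s.selbergSum_pos hz).ne'
  rw [mainSum_lambdaSquared_eq_sum_mul_sum_sq]
  calc _ = ∑ l ∈ s.prodPrimes.divisors, if l ≤ z then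
        (s.selbergSum z)⁻¹ ^ 2 * s.selbergTerms l else 0 := by
        refine sum_congr rfl fun l hl => ?_
        have hlP := Nat.dvd_of_mem_divisors hl
        have hh := (s.selbergTerms_pos hlP).ne'
        rw [sum_nu_mul_selbergWeight hlP]
        split_ifs
        · have : ((μ l : ℤ) : ℝ) ^ 2 = 1 := by
            exact_mod_cast ArithmeticFunction.moebius_sq_eq_one_of_squarefree
              (squarefree_of_dvd_prodPrimes hlP)
          rw [mul_pow, mul_pow, this]
          field_simp
        · simp
    _ = _ := by
        rw [← sum_filter, ← mul_sum, ← selbergSum]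
        field_simp

theorem abs_selbergWeight_le (hz : 1 ≤ z) (hnu : ∀ d, d ∣ s.prodPrimes → (s.nu d)⁻¹ ≤ d) {d : ℕ}
    (hd : d ∣ s.prodPrimes) : |s.selbergWeight z d| ≤ if d ≤ z then (d : ℝ) else 0 := by
  have hG := s.selbergSum_pos hz
  split_ifs with hdz
  · have hT : ∀ m ∈ s.prodPrimes.divisors.filter (fun m => m ≤ z), 0 ≤ s.selbergTerms m :=
      fun m hm => (selbergTerms_pos (Nat.dvd_of_mem_divisors (mem_filter.1 hm).1)).le
    have hsub : s.prodPrimes.divisors.filter (fun m => m ≤ z ∧ d ∣ m) ⊆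
        s.prodPrimes.divisors.filter (fun m => m ≤ z) :=
      monotone_filter_right _ fun m _ h => h.1
    have h0 : 0 ≤ ∑ m ∈ s.prodPrimes.divisors with m ≤ z ∧ d ∣ m, s.selbergTerms m :=
      sum_nonneg fun m hm => hT m (hsub hm)
    have h1 : ∑ m ∈ s.prodPrimes.divisors with m ≤ z ∧ d ∣ m, s.selbergTerms m ≤ s.selbergSum z :=
      sum_le_sum_of_subset_of_nonneg hsub fun m hm _ => hT m hm
    have h2 : |(μ d : ℝ)| ≤ 1 := by exact_mod_cast ArithmeticFunction.abs_moebius_le_one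
    have hn := s.nu_pos_of_dvd_prodPrimes hd
    rw [selbergWeight, abs_mul, abs_mul, abs_mul, abs_of_pos (inv_pos.2 hn),
      abs_of_pos (inv_pos.2 hG), abs_of_nonneg h0]
    calc _ ≤ 1 * (d : ℝ) * (s.selbergSum z)⁻¹ * s.selbergSum z := by
          gcongr
          exact hnu d hd
      _ = d := by field_simp
  · rw [selbergWeight, filter_false_of_mem, sum_empty, mul_zero, abs_zero]
    rintro m hm ⟨h1, h2⟩
    exact hdz ((Nat.le_of_dvd (Nat.pos_of_mem_divisors hm) h2).trans h1)

theorem errSum_selbergWeight_le (hz : 1 ≤ z) (hnu : ∀ d, d ∣ s.prodPrimes → (s.nu d)⁻¹ ≤ d)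
    (hrem : ∀ d, d ∣ s.prodPrimes → |s.rem d| ≤ d) :
    s.errSum (lambdaSquared (s.selbergWeight z)) ≤ (z : ℝ) ^ 6 := by
  set w := s.selbergWeight z
  have hP := s.prodPrimes_ne_zero
  have step : ∀ d ∈ s.prodPrimes.divisors, |lambdaSquared w d| * |s.rem d| ≤
      ∑ d1 ∈ s.prodPrimes.divisors, ∑ d2 ∈ s.prodPrimes.divisors,
        if d = Nat.lcm d1 d2 then |w d1| * |w d2| * (d1 * d2) else 0 := by
    intro d hd
    have hdP := Nat.dvd_of_mem_divisors hd
    have hsub := Nat.divisors_subset_of_dvd hP hdP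
    have hnn : ∀ d1 d2 : ℕ,
        0 ≤ if d = Nat.lcm d1 d2 then |w d1| * |w d2| * ((d1 : ℝ) * d2) else 0 := by
      intro d1 d2; split_ifs <;> positivity
    calc |lambdaSquared w d| * |s.rem d|
        ≤ (∑ d1 ∈ d.divisors, ∑ d2 ∈ d.divisors,
            |if d = Nat.lcm d1 d2 then w d1 * w d2 else 0|) * d := by
          refine mul_le_mul ?_ (hrem d hdP) (abs_nonneg _)
            (sum_nonneg fun _ _ => sum_nonneg fun _ _ => abs_nonneg _)
          exact (abs_sum_le_sum_abs _ _).trans (sum_le_sum fun _ _ => abs_sum_le_sum_abs _ _)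
      _ ≤ ∑ d1 ∈ d.divisors, ∑ d2 ∈ d.divisors,
            if d = Nat.lcm d1 d2 then |w d1| * |w d2| * ((d1 : ℝ) * d2) else 0 := by
          rw [sum_mul]
          refine sum_le_sum fun d1 h1 => ?_
          rw [sum_mul]
          refine sum_le_sum fun d2 h2 => ?_
          split_ifs with h
          · rw [abs_mul]
            gcongr
            have : d ≤ d1 * d2 := h.trans_le (Nat.le_of_dvd (Nat.mul_pos
              (Nat.pos_of_mem_divisors h1) (Nat.pos_of_mem_divisors h2)) (Nat.lcm_dvd_mul _ _))
            exact_mod_cast this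
          · simp
      _ ≤ _ := by
          refine (sum_le_sum fun d1 _ => sum_le_sum_of_subset_of_nonneg hsub
            fun d2 _ _ => hnn d1 d2).trans ?_
          exact sum_le_sum_of_subset_of_nonneg hsub fun d1 _ _ => sum_nonneg fun d2 _ => hnn d1 d2
  have h1 : ∑ d ∈ s.prodPrimes.divisors, |w d| * d ≤ (z : ℝ) ^ 3 := by
    calc ∑ d ∈ s.prodPrimes.divisors, |w d| * d
        ≤ ∑ d ∈ s.prodPrimes.divisors, if d ≤ z then (z : ℝ) * z else 0 := by
          refine sum_le_sum fun d hd => ?_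
          have := abs_selbergWeight_le hz hnu (Nat.dvd_of_mem_divisors hd)
          split_ifs at this ⊢ with h
          · have h' : (d : ℝ) ≤ z := by exact_mod_cast h
            exact mul_le_mul (this.trans h') h' (by positivity) (by positivity)
          · have h0 : |w d| = 0 := le_antisymm this (abs_nonneg _)
            rw [h0, zero_mul]
      _ = #{d ∈ s.prodPrimes.divisors | d ≤ z} * ((z : ℝ) * z) := by
          rw [← sum_filter, sum_const, nsmul_eq_mul]
      _ ≤ z * ((z : ℝ) * z) := by
          gcongr
          have : {d ∈ s.prodPrimes.divisors | d ≤ z} ⊆ Icc 1 z := fun d hd => by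
            rw [mem_filter] at hd
            exact mem_Icc.2 ⟨Nat.pos_of_mem_divisors hd.1, hd.2⟩
          simpa using card_le_card this
      _ = (z : ℝ) ^ 3 := by ring
  calc s.errSum (lambdaSquared w)
      ≤ ∑ d ∈ s.prodPrimes.divisors, ∑ d1 ∈ s.prodPrimes.divisors, ∑ d2 ∈ s.prodPrimes.divisors,
        if d = Nat.lcm d1 d2 then |w d1| * |w d2| * ((d1 : ℝ) * d2) else 0 := sum_le_sum step
    _ = ∑ d1 ∈ s.prodPrimes.divisors, ∑ d2 ∈ s.prodPrimes.divisors,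
          |w d1| * |w d2| * ((d1 : ℝ) * d2) := by
        rw [sum_comm]
        refine sum_congr rfl fun d1 h1 => ?_
        rw [sum_comm]
        refine sum_congr rfl fun d2 h2 => ?_
        rw [sum_ite_eq', if_pos]
        exact Nat.mem_divisors.2 ⟨Nat.lcm_dvd (Nat.dvd_of_mem_divisors h1)
          (Nat.dvd_of_mem_divisors h2), hP⟩
    _ = (∑ d ∈ s.prodPrimes.divisors, |w d| * d) ^ 2 := by
        rw [sq, sum_mul_sum]
        exact sum_congr rfl fun _ _ => sum_congr rfl fun _ _ => by ring
    _ ≤ ((z : ℝ) ^ 3) ^ 2 := by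
        gcongr
    _ = (z : ℝ) ^ 6 := by ring

/-- Selberg's upper bound sieve. -/
theorem siftedSum_le_selberg (hz : 1 ≤ z) (hnu : ∀ d, d ∣ s.prodPrimes → (s.nu d)⁻¹ ≤ d)
    (hrem : ∀ d, d ∣ s.prodPrimes → |s.rem d| ≤ d) :
    s.siftedSum ≤ s.totalMass / s.selbergSum z + (z : ℝ) ^ 6 := by
  have h := siftedSum_le_mainSum_errSum_of_upperMoebius (s := s) _
    (upperMoebius_lambdaSquared _ (selbergWeight_one (s := s) hz))
  rw [mainSum_selbergWeight hz] at h
  rw [div_eq_mul_inv]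
  exact h.trans (add_le_add_right (errSum_selbergWeight_le hz hnu hrem) _)

end BoundingSieve

theorem sum_log_div_primesLE_le (k : ℕ) :
    ∑ p ∈ Nat.primesLE (2 ^ k), Real.log p / p ≤ 2 * Real.log 4 * k := by
  induction k with
  | zero => simp [Nat.primesLE]
  | succ k ih =>
    have hsub : Nat.primesLE (2 ^ k) ⊆ Nat.primesLE (2 ^ (k + 1)) := fun p hp => by
      rw [Nat.mem_primesLE] at hp ⊢
      exact ⟨hp.1.trans (Nat.pow_le_pow_right two_pos k.le_succ), hp.2⟩
    rw [← sum_sdiff hsub]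
    have h1 : ∑ p ∈ Nat.primesLE (2 ^ (k + 1)) \ Nat.primesLE (2 ^ k), Real.log p / p ≤
        Chebyshev.theta ((2 ^ (k + 1) : ℕ) : ℝ) / 2 ^ k := by
      rw [Chebyshev.theta_eq_sum_primesLE_log, sum_div]
      refine (sum_le_sum fun p hp => ?_).trans (sum_le_sum_of_subset_of_nonneg sdiff_subset
        fun p _ _ => div_nonneg (Real.log_natCast_nonneg p) (by positivity))
      rw [mem_sdiff, Nat.mem_primesLE, Nat.mem_primesLE] at hp
      have hlt : 2 ^ k < p := by
        by_contra h
        exact hp.2 ⟨not_lt.1 h, hp.1.2⟩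
      have : (2 : ℝ) ^ k ≤ p := by exact_mod_cast hlt.le
      exact div_le_div_of_nonneg_left (Real.log_natCast_nonneg p) (by positivity) this
    have h2 : Chebyshev.theta ((2 ^ (k + 1) : ℕ) : ℝ) / 2 ^ k ≤ 2 * Real.log 4 := by
      rw [div_le_iff₀ (by positivity)]
      refine (Chebyshev.theta_le_log4_mul_x (by positivity)).trans (le_of_eq ?_)
      push_cast
      ring
    push_cast
    linarith

theorem exists_sum_log_div_primesLE_le :
    ∃ C : ℝ, 0 < C ∧ ∀ x : ℕ, 2 ≤ x →
      ∑ p ∈ Nat.primesLE x, Real.log p / p ≤ C * Real.log x := by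
  have hl2 : 0 < Real.log 2 := Real.log_pos (by norm_num)
  have hl4 : 0 < Real.log 4 := Real.log_pos (by norm_num)
  refine ⟨2 * Real.log 4 * (2 / Real.log 2), by positivity, fun x hx => ?_⟩
  set k := Nat.log 2 x
  have hk : x ≤ 2 ^ (k + 1) := (Nat.lt_pow_succ_log_self one_lt_two x).le
  have hk1 : 1 ≤ k := Nat.log_pos one_lt_two hx
  have hkx : 2 ^ k ≤ x := Nat.pow_log_le_self 2 (by omega)
  have hsub : Nat.primesLE x ⊆ Nat.primesLE (2 ^ (k + 1)) := fun p hp => by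
    rw [Nat.mem_primesLE] at hp ⊢
    exact ⟨hp.1.trans hk, hp.2⟩
  refine (sum_le_sum_of_subset_of_nonneg hsub
    fun p _ _ => div_nonneg (Real.log_natCast_nonneg p) (by positivity)).trans
      ((sum_log_div_primesLE_le (k + 1)).trans ?_)
  rw [mul_assoc _ (2 / Real.log 2)]
  gcongr
  have h1 : (k : ℝ) * Real.log 2 ≤ Real.log x := by
    rw [← Real.log_pow]
    exact Real.log_le_log (by positivity) (by exact_mod_cast hkx)
  have h2 : (1 : ℝ) ≤ k := by exact_mod_cast hk1
  rw [div_mul_eq_mul_div, le_div_iff₀ hl2]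
  push_cast
  nlinarith

theorem prod_inv_one_sub_rpow_le_tsum {s : ℝ} (hs : 1 < s) (S : Finset ℕ)
    (hS : ∀ p ∈ S, p.Prime) :
    ∏ p ∈ S, (1 - (p : ℝ) ^ (-s))⁻¹ ≤ ∑' n : ℕ, 1 / (n : ℝ) ^ s := by
  let f : ℕ →* ℝ :=
    { toFun := fun n => (n : ℝ) ^ (-s)
      map_one' := by simp
      map_mul' := fun m n => by
        push_cast
        exact Real.mul_rpow (by positivity) (by positivity) }
  have hf : ∀ n, f n = 1 / (n : ℝ) ^ s := fun n => by
    simp only [f, MonoidHom.coe_mk, OneHom.coe_mk]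
    rw [Real.rpow_neg (by positivity), one_div]
  have hsum : Summable fun n : ℕ => f n := by
    simp only [hf]
    exact Real.summable_one_div_nat_rpow.2 hs
  have hn : ∀ n, 0 ≤ f n := fun n => by rw [hf]; positivity
  have h := EulerProduct.prod_filter_prime_geometric_eq_tsum_factoredNumbers hsum S
  rw [filter_true_of_mem hS] at h
  change ∏ p ∈ S, (1 - f p)⁻¹ ≤ _
  rw [h]
  simp only [← hf]
  exact hsum.tsum_subtype_le _ _ hn

theorem exists_prod_primesLE_le :
    ∃ C : ℝ, 0 < C ∧ ∃ x0 : ℕ, ∀ x : ℕ, x0 ≤ x →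
      ∏ p ∈ Nat.primesLE x, (1 - (p : ℝ)⁻¹)⁻¹ ≤ C * Real.log x := by
  obtain ⟨C, hC, hlog⟩ := exists_sum_log_div_primesLE_le
  have htend : Filter.Tendsto (fun x : ℕ => 1 + (Real.log x)⁻¹) Filter.atTop (nhdsWithin 1 (Set.Ioi 1)) := by
    rw [tendsto_nhdsWithin_iff]
    have hl : Filter.Tendsto (fun x : ℕ => Real.log x) Filter.atTop Filter.atTop :=
      Real.tendsto_log_atTop.comp tendsto_natCast_atTop_atTop
    constructor
    · simpa using (hl.inv_tendsto_atTop).const_add 1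
    · filter_upwards [hl.eventually_gt_atTop 0] with x hx
      have := inv_pos.2 hx
      simpa using this
  have hev := (tendsto_sub_mul_tsum_nat_rpow.comp htend).eventually
    (gt_mem_nhds (show (1 : ℝ) < 2 by norm_num))
  obtain ⟨x1, hx1⟩ := Filter.eventually_atTop.1 hev
  refine ⟨Real.exp (2 * C) * 2, by positivity, max x1 2, fun x hx => ?_⟩
  have hx2 : 2 ≤ x := (le_max_right _ _).trans hx
  have hL : 0 < Real.log x := Real.log_pos (by exact_mod_cast hx2)
  set s : ℝ := 1 + (Real.log x)⁻¹ with hs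
  have hs1 : 1 < s := by rw [hs]; linarith [inv_pos.2 hL]
  have hz : ∑' n : ℕ, 1 / (n : ℝ) ^ s ≤ 2 * Real.log x := by
    have := hx1 x ((le_max_left _ _).trans hx)
    simp only [Function.comp_apply, ← hs] at this
    have h2 : s - 1 = (Real.log x)⁻¹ := by rw [hs]; ring
    rw [h2, inv_mul_lt_iff₀ hL] at this
    linarith
  have hpr : ∀ p ∈ Nat.primesLE x, p.Prime := fun p hp => (Nat.mem_primesLE.1 hp).2
  have hterm : ∀ p ∈ Nat.primesLE x, (1 - (p : ℝ)⁻¹)⁻¹ ≤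
      Real.exp (2 * (Real.log x)⁻¹ * (Real.log p / p)) * (1 - (p : ℝ) ^ (-s))⁻¹ := by
    intro p hp
    have hp2 : (2 : ℝ) ≤ p := by exact_mod_cast (hpr p hp).two_le
    have hp0 : (0 : ℝ) < p := by linarith
    have hi : (p : ℝ)⁻¹ ≤ 1 / 2 := by rw [inv_le_comm₀ hp0 (by norm_num)]; linarith
    have hip : 0 < (p : ℝ)⁻¹ := inv_pos.2 hp0
    have e : (p : ℝ) ^ (-s) = (p : ℝ)⁻¹ * Real.exp (-((Real.log x)⁻¹ * Real.log p)) := by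
      rw [hs, neg_add, Real.rpow_add hp0, Real.rpow_neg_one, Real.rpow_def_of_pos hp0]
      congr 2; ring
    set t := (Real.log x)⁻¹ * Real.log p with ht
    have ht0 : 0 ≤ t := mul_nonneg (inv_pos.2 hL).le (Real.log_natCast_nonneg p)
    have h1 : 1 - t ≤ Real.exp (-t) := by linarith [Real.add_one_le_exp (-t)]
    have h2 : Real.exp (-t) ≤ 1 := Real.exp_le_one_iff.2 (by linarith)
    have h3 : 0 < 1 - (p : ℝ) ^ (-s) := by rw [e]; nlinarith
    have h4 : 0 < 1 - (p : ℝ)⁻¹ := by linarith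
    rw [← div_eq_mul_inv, le_div_iff₀ h3, inv_mul_le_iff₀ h4]
    have h5 : 2 * (Real.log x)⁻¹ * (Real.log p / p) = 2 * (p : ℝ)⁻¹ * t := by
      rw [ht]; field_simp
    rw [h5, e]
    have h6 : 1 + 2 * (p : ℝ)⁻¹ * t ≤ Real.exp (2 * (p : ℝ)⁻¹ * t) := by
      linarith [Real.add_one_le_exp (2 * (p : ℝ)⁻¹ * t)]
    refine le_trans ?_ (mul_le_mul_of_nonneg_left h6 h4.le)
    have h7 := mul_le_mul_of_nonneg_left h1 hip.le
    have h8 : 0 ≤ (p : ℝ)⁻¹ * t := mul_nonneg hip.le ht0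
    nlinarith
  calc ∏ p ∈ Nat.primesLE x, (1 - (p : ℝ)⁻¹)⁻¹
      ≤ ∏ p ∈ Nat.primesLE x,
        (Real.exp (2 * (Real.log x)⁻¹ * (Real.log p / p)) * (1 - (p : ℝ) ^ (-s))⁻¹) := by
        refine prod_le_prod (fun p hp => ?_) hterm
        exact inv_nonneg.2 (sub_nonneg.2 (Nat.cast_inv_le_one p))
    _ = Real.exp (2 * (Real.log x)⁻¹ * ∑ p ∈ Nat.primesLE x, Real.log p / p) *
        ∏ p ∈ Nat.primesLE x, (1 - (p : ℝ) ^ (-s))⁻¹ := by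
        rw [prod_mul_distrib, ← Real.exp_sum, mul_sum]
    _ ≤ Real.exp (2 * C) * (2 * Real.log x) := by
        refine mul_le_mul (Real.exp_le_exp.2 ?_)
          ((prod_inv_one_sub_rpow_le_tsum hs1 _ hpr).trans hz) ?_ (Real.exp_pos _).le
        · calc _ ≤ 2 * (Real.log x)⁻¹ * (C * Real.log x) := by
                gcongr
                exact hlog x hx2
            _ = 2 * C := by field_simp
        · refine prod_nonneg fun p hp => inv_nonneg.2 (sub_nonneg.2 ?_)
          exact Real.rpow_le_one_of_one_le_of_nonpos
            (by exact_mod_cast (hpr p hp).one_lt.le) (by linarith)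
    _ = _ := by ring

theorem prod_primeFactors_le {D x : ℕ} (hD : D ≠ 0) (hx : 2 ≤ x) (hDx : Real.log D ≤ x) :
    ∏ p ∈ D.primeFactors, (1 - (p : ℝ)⁻¹)⁻¹ ≤
      Real.exp 4 * ∏ p ∈ Nat.primesLE x, (1 - (p : ℝ)⁻¹)⁻¹ := by
  have hx0 : (2 : ℝ) ≤ x := by exact_mod_cast hx
  have hone : ∀ p : ℕ, p.Prime → 1 ≤ (1 - (p : ℝ)⁻¹)⁻¹ := fun p hp => by
    have hp2 : (2 : ℝ) ≤ p := by exact_mod_cast hp.two_le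
    have h1 : (p : ℝ)⁻¹ < 1 := inv_lt_one_of_one_lt₀ (by linarith)
    have h2 : 0 ≤ (p : ℝ)⁻¹ := by positivity
    exact (one_le_inv₀ (by linarith)).2 (by linarith)
  rw [← prod_filter_not_mul_prod_filter D.primeFactors (fun p => p ≤ x)]
  refine mul_le_mul ?_ ?_ (prod_nonneg fun p hp => ?_) (Real.exp_pos _).le
  · set S := D.primeFactors.filter fun p => ¬ p ≤ x with hSdef
    have hS : ∀ p ∈ S, p.Prime ∧ x < p := fun p hp => by
      rw [hSdef, mem_filter] at hp
      exact ⟨Nat.prime_of_mem_primeFactors hp.1, not_le.1 hp.2⟩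
    have hterm : ∀ p ∈ S, (1 - (p : ℝ)⁻¹)⁻¹ ≤ Real.exp (2 / x) := fun p hp => by
      have hxp : (x : ℝ) ≤ p := by exact_mod_cast (hS p hp).2.le
      have h1 : (p : ℝ)⁻¹ ≤ (x : ℝ)⁻¹ := inv_anti₀ (by linarith) hxp
      have h2 : (x : ℝ)⁻¹ ≤ 1 / 2 := by rw [inv_le_comm₀ (by linarith) (by norm_num)]; linarith
      have h3 : 0 < (x : ℝ)⁻¹ := by positivity
      have h4 : 1 + 2 / (x : ℝ) ≤ Real.exp (2 / x) := by linarith [Real.add_one_le_exp (2 / (x : ℝ))]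
      refine le_trans ?_ h4
      rw [inv_le_iff_one_le_mul₀ (by linarith), div_eq_mul_inv]
      nlinarith
    have hcard : (#S : ℝ) ≤ 2 * x := by
      have h1 : ∏ p ∈ S, (p : ℝ) ≤ D := by
        have : ∏ p ∈ S, p ∣ D :=
          (prod_dvd_prod_of_subset _ _ _ (filter_subset _ _)).trans (Nat.prod_primeFactors_dvd D)
        rw [← Nat.cast_prod]
        exact_mod_cast Nat.le_of_dvd (Nat.pos_of_ne_zero hD) this
      have h2 : (2 : ℝ) ^ #S ≤ D := by
        refine le_trans ?_ h1
        rw [← prod_const]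
        exact prod_le_prod (fun _ _ => by norm_num) fun p hp => by
          exact_mod_cast (hS p hp).1.two_le
      have h3 := Real.log_le_log (by positivity) h2
      rw [Real.log_pow] at h3
      have := Real.log_two_gt_d9
      have h4 : (0 : ℝ) ≤ #S := by positivity
      nlinarith
    calc ∏ p ∈ S, (1 - (p : ℝ)⁻¹)⁻¹ ≤ ∏ _p ∈ S, Real.exp (2 / x) :=
          prod_le_prod (fun p hp => zero_le_one.trans (hone p (hS p hp).1)) hterm
      _ = Real.exp (#S * (2 / x)) := by rw [prod_const, ← Real.exp_nat_mul]
      _ ≤ Real.exp 4 := by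
          refine Real.exp_le_exp.2 ?_
          rw [mul_div_assoc', div_le_iff₀ (by linarith)]
          linarith
  · refine prod_le_prod_of_subset_of_one_le ?_ (fun p hp => ?_) ?_
    · intro p hp
      rw [mem_filter] at hp
      exact Nat.mem_primesLE.2 ⟨hp.2, Nat.prime_of_mem_primeFactors hp.1⟩
    · exact zero_le_one.trans (hone p (Nat.prime_of_mem_primeFactors (mem_filter.1 hp).1))
    · exact fun p hp _ => hone p (Nat.mem_primesLE.1 hp).2
  · exact zero_le_one.trans (hone p (Nat.prime_of_mem_primeFactors (mem_filter.1 hp).1))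

/-- The number of roots modulo `d` of `x * (r * x + 1) * (a - r * x)`. -/
noncomputable def tripletRoots (r a : ℤ) (d : ℕ) : ℕ :=
  Nat.card {x : ZMod d // x * ((r : ZMod d) * x + 1) * ((a : ZMod d) - r * x) = 0}

theorem tripletRoots_mul (r a : ℤ) {m n : ℕ} (h : m.Coprime n) :
    tripletRoots r a (m * n) = tripletRoots r a m * tripletRoots r a n := by
  let e := ZMod.chineseRemainder h
  rw [tripletRoots, tripletRoots, tripletRoots, ← Nat.card_prod]
  refine Nat.card_congr ((e.toEquiv.subtypeEquiv (q := fun y : ZMod m × ZMod n =>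
    y.1 * ((r : ZMod m) * y.1 + 1) * ((a : ZMod m) - r * y.1) = 0 ∧
    y.2 * ((r : ZMod n) * y.2 + 1) * ((a : ZMod n) - r * y.2) = 0) fun x => ?_).trans
    (Equiv.subtypeProdEquivProd
      (p := fun x : ZMod m => x * ((r : ZMod m) * x + 1) * ((a : ZMod m) - r * x) = 0)
      (q := fun x : ZMod n => x * ((r : ZMod n) * x + 1) * ((a : ZMod n) - r * x) = 0)))
  rw [← e.map_eq_zero_iff, Prod.ext_iff]
  simp

theorem tripletRoots_one (r a : ℤ) : tripletRoots r a 1 = 1 := by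
  rw [tripletRoots, Nat.card_eq_one_iff_unique]
  exact ⟨inferInstance, ⟨0, Subsingleton.elim _ _⟩⟩

theorem tripletRoots_pos (r a : ℤ) {d : ℕ} (hd : d ≠ 0) : 0 < tripletRoots r a d := by
  have : NeZero d := ⟨hd⟩
  rw [tripletRoots, Nat.card_pos_iff]
  exact ⟨⟨0, by simp⟩, inferInstance⟩

theorem tripletRoots_le (r a : ℤ) {d : ℕ} (hd : d ≠ 0) : tripletRoots r a d ≤ d := by
  have : NeZero d := ⟨hd⟩
  refine (Finite.card_subtype_le _).trans (by simp)

theorem dvd_triplet_of_tripletRoots_eq (r a : ℤ) {p : ℕ} (hp : p ≠ 0)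
    (h : tripletRoots r a p = p) (q : ℤ) : (p : ℤ) ∣ q * (r * q + 1) * (a - r * q) := by
  have : NeZero p := ⟨hp⟩
  rw [tripletRoots, Nat.card_eq_fintype_card] at h
  classical
  have h2 : Fintype.card {x : ZMod p // x * ((r : ZMod p) * x + 1) * ((a : ZMod p) - r * x) = 0} =
      Fintype.card (ZMod p) := by rw [ZMod.card]; convert h
  rw [Fintype.card_subtype, Finset.card_eq_iff_eq_univ, Finset.filter_eq_self] at h2
  rw [← ZMod.intCast_zmod_eq_zero_iff_dvd]
  push_cast
  exact h2 _ (mem_univ _)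

theorem three_le_tripletRoots {r a : ℤ} {p : ℕ} (hp : p.Prime) (h : ¬ (p : ℤ) ∣ r * a * (a + 1)) :
    3 ≤ tripletRoots r a p := by
  have : Fact p.Prime := ⟨hp⟩
  rw [← ZMod.intCast_zmod_eq_zero_iff_dvd] at h
  push_cast at h
  simp only [mul_eq_zero, not_or] at h
  obtain ⟨⟨hr, ha⟩, ha1⟩ := h
  rw [tripletRoots, Nat.card_eq_fintype_card, Fintype.card_subtype]
  have hs : ({0, -(r : ZMod p)⁻¹, (a : ZMod p) * (r : ZMod p)⁻¹} : Finset (ZMod p)) ⊆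
      univ.filter fun x : ZMod p => x * ((r : ZMod p) * x + 1) * ((a : ZMod p) - r * x) = 0 := by
    intro x hx
    rw [mem_filter]
    refine ⟨mem_univ _, ?_⟩
    simp only [mem_insert, mem_singleton] at hx
    rcases hx with rfl | rfl | rfl
    · simp
    · simp [hr]
    · have : (a : ZMod p) - r * (a * (r : ZMod p)⁻¹) = 0 := by field_simp; ring
      simp [this]
  refine le_trans (le_of_eq ?_) (card_le_card hs)
  rw [card_eq_three.2]
  refine ⟨_, _, _, ?_, ?_, ?_, rfl⟩
  · simpa using fun h => hr h
  · simpa [eq_comm] using And.intro ha hr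
  · intro h
    apply ha1
    have h' : (r : ZMod p) * (-(r : ZMod p)⁻¹) = r * (a * (r : ZMod p)⁻¹) := by rw [h]
    field_simp at h'
    rw [← h']; ring

theorem abs_count_modEq_sub_le {d : ℕ} (hd : 0 < d) (Y v : ℕ) :
    |(#{q ∈ range Y | q ≡ v [MOD d]} : ℝ) - Y / d| ≤ 1 := by
  rw [← Nat.count_eq_card_filter_range, Nat.count_modEq_card Y hd]
  have h1 : (d : ℝ) * (Y / d : ℕ) + (Y % d : ℕ) = Y := by exact_mod_cast Nat.div_add_mod Y d
  have hd' : (0 : ℝ) < d := by exact_mod_cast hd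
  have h2 : ((Y % d : ℕ) : ℝ) < d := by exact_mod_cast Nat.mod_lt Y hd
  have h3 : (0 : ℝ) ≤ (Y % d : ℕ) := by positivity
  have h4 : (Y : ℝ) / d = (Y / d : ℕ) + (Y % d : ℕ) / d := by rw [← h1]; field_simp
  have h5 : ((Y % d : ℕ) : ℝ) / d ≤ 1 := (div_le_one hd').2 h2.le
  have h6 : 0 ≤ ((Y % d : ℕ) : ℝ) / d := by positivity
  rw [h4, abs_le]
  push_cast
  split_ifs <;> constructor <;> norm_num <;> linarith

theorem abs_card_dvd_triplet_sub_le (r a : ℤ) {d : ℕ} (hd : d ≠ 0) (Y : ℕ) :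
    |(#((range Y).filter fun q : ℕ => (d : ℤ) ∣ (q : ℤ) * (r * q + 1) * (a - r * q)) : ℝ) -
      tripletRoots r a d / d * Y| ≤ tripletRoots r a d := by
  have : NeZero d := ⟨hd⟩
  classical
  set R : Finset (ZMod d) := univ.filter fun x : ZMod d =>
    x * ((r : ZMod d) * x + 1) * ((a : ZMod d) - r * x) = 0 with hR
  have hcard : tripletRoots r a d = #R := by
    rw [tripletRoots, Nat.card_eq_fintype_card, Fintype.card_subtype]
  have e : #((range Y).filter fun q : ℕ => (d : ℤ) ∣ (q : ℤ) * (r * q + 1) * (a - r * q)) =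
      ∑ x ∈ R, #{q ∈ range Y | q ≡ x.val [MOD d]} := by
    rw [card_eq_sum_card_fiberwise (f := fun q : ℕ => (q : ZMod d)) (t := R)]
    · refine sum_congr rfl fun x hx => ?_
      rw [filter_filter]
      congr 1
      refine filter_congr fun q _ => ?_
      rw [← ZMod.natCast_eq_natCast_iff, ZMod.natCast_zmod_val]
      refine ⟨fun h => h.2, fun h => ⟨?_, h⟩⟩
      rw [← ZMod.intCast_zmod_eq_zero_iff_dvd]
      push_cast
      rw [h]
      exact (mem_filter.1 hx).2
    · intro q hq
      have := (mem_filter.1 hq).2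
      rw [← ZMod.intCast_zmod_eq_zero_iff_dvd] at this
      push_cast at this
      exact mem_filter.2 ⟨mem_univ _, this⟩
  rw [e, hcard]
  have h2 : ((∑ x ∈ R, #{q ∈ range Y | q ≡ x.val [MOD d]} : ℕ) : ℝ) - (#R : ℝ) / d * Y =
      ∑ x ∈ R, ((#{q ∈ range Y | q ≡ x.val [MOD d]} : ℝ) - Y / d) := by
    rw [sum_sub_distrib, sum_const, nsmul_eq_mul]
    push_cast
    ring
  rw [h2]
  refine (abs_sum_le_sum_abs _ _).trans ?_
  refine (sum_le_sum fun x _ => abs_count_modEq_sub_le (Nat.pos_of_ne_zero hd) Y x.val).trans ?_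
  simp

theorem sum_completelyMultiplicative_nu_le_selbergSum (s : BoundingSieve) {z : ℕ}
    (hP : s.prodPrimes = primorial z) (h0 : ∀ n, 0 ≤ s.nu n)
    (h1 : ∀ p : ℕ, p.Prime → s.nu p < 1) :
    ∑ m ∈ Icc 1 z, completelyMultiplicative (fun p => s.nu p) m ≤ s.selbergSum z := by
  set f := completelyMultiplicative fun p => s.nu p with hf
  have hrad : ∀ m ∈ Icc 1 z, ∏ p ∈ m.primeFactors, p ∈
      s.prodPrimes.divisors.filter fun m => m ≤ z := by
    intro m hm
    rw [mem_Icc] at hm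
    have hm0 : 0 < m := hm.1
    rw [mem_filter, Nat.mem_divisors]
    refine ⟨⟨?_, s.prodPrimes_ne_zero⟩, (Nat.le_of_dvd hm0 (Nat.prod_primeFactors_dvd m)).trans hm.2⟩
    rw [hP, primorial]
    refine prod_dvd_prod_of_subset _ _ _ fun p hp => ?_
    rw [mem_filter, mem_range]
    exact ⟨Nat.lt_succ_of_le ((Nat.le_of_mem_primeFactors hp).trans hm.2),
      Nat.prime_of_mem_primeFactors hp⟩
  rw [← sum_fiberwise_of_maps_to hrad, BoundingSieve.selbergSum]
  refine sum_le_sum fun k hk => ?_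
  have hkP : k ∣ s.prodPrimes := Nat.dvd_of_mem_divisors (mem_filter.1 hk).1
  have hk0 : k ≠ 0 := ne_zero_of_dvd_ne_zero s.prodPrimes_ne_zero hkP
  set T := (Icc 1 z).filter fun m => ∏ p ∈ m.primeFactors, p = k with hT
  have hmem : ∀ m ∈ T, m ≠ 0 ∧ k ∣ m ∧ m.primeFactors = k.primeFactors := by
    intro m hm
    rw [hT, mem_filter, mem_Icc] at hm
    obtain ⟨hm, rfl⟩ := hm
    exact ⟨by omega, Nat.prod_primeFactors_dvd m,
      (Nat.primeFactors_prod fun p hp => Nat.prime_of_mem_primeFactors hp).symm⟩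
  have hfk : f k = s.nu k := by
    rw [← BoundingSieve.prod_primeFactors_nu hkP]
    conv_lhs => rw [← Nat.prod_primeFactors_of_squarefree
      (BoundingSieve.squarefree_of_dvd_prodPrimes hkP)]
    rw [map_prod]
    exact prod_congr rfl fun p hp =>
      completelyMultiplicative_prime _ (Nat.prime_of_mem_primeFactors hp)
  calc ∑ m ∈ T, f m = ∑ m ∈ T, f k * f (m / k) := by
        refine sum_congr rfl fun m hm => ?_
        rw [← map_mul, Nat.mul_div_cancel' (hmem m hm).2.1]
    _ = f k * ∑ c ∈ T.image (· / k), f c := by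
        rw [← mul_sum, sum_image]
        intro m hm m' hm' h
        dsimp only at h
        rw [← Nat.mul_div_cancel' (hmem m hm).2.1, ← Nat.mul_div_cancel' (hmem m' hm').2.1, h]
    _ ≤ s.nu k * ∏ p ∈ k.primeFactors with p.Prime, (1 - s.nu p)⁻¹ := by
        rw [hfk]
        refine mul_le_mul_of_nonneg_left ?_ (h0 k)
        refine sum_completelyMultiplicative_le_prod h0 h1 _ _ fun c hc => ?_
        obtain ⟨m, hm, rfl⟩ := mem_image.1 hc
        obtain ⟨hm0, hkm, hmk⟩ := hmem m hm
        rw [Nat.mem_factoredNumbers_iff_primeFactors_subset]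
        have hdvd : m / k ∣ m := Nat.div_dvd_of_dvd hkm
        exact ⟨ne_zero_of_dvd_ne_zero hm0 hdvd, hmk ▸ Nat.primeFactors_mono hdvd hm0⟩
    _ = s.selbergTerms k := by
        rw [filter_true_of_mem fun p hp => Nat.prime_of_mem_primeFactors hp,
          BoundingSieve.selbergTerms_apply]

theorem log_le_sum_coprime_mul_prod {D : ℕ} (hD : D ≠ 0) (y : ℕ) :
    Real.log (y + 1) ≤
      (∑ m ∈ Icc 1 y, completelyMultiplicative (fun p => if p ∣ D then 0 else (p : ℝ)⁻¹) m) *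
        ∏ p ∈ D.primeFactors, (1 - (p : ℝ)⁻¹)⁻¹ := by
  let h : ℕ →* ℝ :=
    { toFun := fun n => (n : ℝ)⁻¹
      map_one' := by simp
      map_mul' := fun m n => by push_cast; rw [mul_inv] }
  set x : ℕ → ℝ := fun p => if p ∣ D then 0 else (p : ℝ)⁻¹ with hx
  set x' : ℕ → ℝ := fun p => if p.Prime ∧ p ∣ D then (p : ℝ)⁻¹ else 0 with hx'
  have hx0 : ∀ p, 0 ≤ x p := fun p => by rw [hx]; dsimp only; split_ifs <;> positivity
  have hx'0 : ∀ p, 0 ≤ x' p := fun p => by rw [hx']; dsimp only; split_ifs <;> positivity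
  have hlt : ∀ p : ℕ, p.Prime → (p : ℝ)⁻¹ < 1 := fun p hp =>
    inv_lt_one_of_one_lt₀ (by exact_mod_cast hp.one_lt)
  have hx'1 : ∀ p : ℕ, p.Prime → x' p < 1 := fun p hp => by
    rw [hx']; dsimp only; split_ifs
    · exact hlt p hp
    · exact one_pos
  have h1 : Real.log (y + 1) ≤ ∑ m ∈ Icc 1 y, h m := by
    have h1 := log_add_one_le_harmonic y
    rw [harmonic_eq_sum_Icc] at h1
    push_cast at h1
    exact h1
  have h2 := sum_le_sum_mul_sum (f := completelyMultiplicative x)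
    (g := completelyMultiplicative x') (h := h)
    (completelyMultiplicative_nonneg hx0) (completelyMultiplicative_nonneg hx'0)
    (fun n => inv_nonneg.2 (Nat.cast_nonneg n)) (fun p hp => by
      rw [completelyMultiplicative_prime _ hp, completelyMultiplicative_prime _ hp]
      change (p : ℝ)⁻¹ ≤ _ ∨ (p : ℝ)⁻¹ ≤ _
      by_cases hpD : p ∣ D
      · right; simp [hx', hpD, hp]
      · left; simp [hx, hpD]) y
  refine h1.trans (h2.trans (mul_le_mul_of_nonneg_left ?_
    (sum_nonneg fun m _ => completelyMultiplicative_nonneg hx0 m)))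
  have h3 := sum_completelyMultiplicative_le_prod hx'0 hx'1 (range (y + 1)) (Icc 1 y)
    (fun m hm => by
      rw [mem_Icc] at hm
      rw [Nat.mem_factoredNumbers_iff_primeFactors_subset]
      refine ⟨by omega, fun p hp => mem_range.2 ?_⟩
      exact Nat.lt_succ_of_le ((Nat.le_of_mem_primeFactors hp).trans hm.2))
  refine h3.trans ?_
  have h4 : ∏ p ∈ range (y + 1) with p.Prime, (1 - x' p)⁻¹ =
      ∏ p ∈ range (y + 1) with p.Prime ∧ p ∣ D, (1 - (p : ℝ)⁻¹)⁻¹ := by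
    rw [← filter_filter, prod_filter (fun p => p ∣ D)]
    refine prod_congr rfl fun p hp => ?_
    have := (mem_filter.1 hp).2
    by_cases hpD : p ∣ D <;> simp [hx', hpD, this]
  rw [h4]
  refine prod_le_prod_of_subset_of_one_le (fun p hp => ?_) (fun p hp => ?_) fun p hp _ => ?_
  · rw [mem_filter] at hp
    exact Nat.mem_primeFactors.2 ⟨hp.2.1, hp.2.2, hD⟩
  · have := hlt p (mem_filter.1 hp).2.1
    exact inv_nonneg.2 (by linarith)
  · have := hlt p (Nat.prime_of_mem_primeFactors hp)
    have h5 : 0 ≤ (p : ℝ)⁻¹ := by positivity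
    exact (one_le_inv₀ (by linarith)).2 (by linarith)

theorem pow_three_sum_le_sum {x : ℕ → ℝ} {D : ℕ}
    (hx0 : ∀ p, 0 ≤ x p) (hx : ∀ p : ℕ, p.Prime → ¬ p ∣ D → 3 * (p : ℝ)⁻¹ ≤ x p) (y : ℕ) :
    (∑ m ∈ Icc 1 y, completelyMultiplicative (fun p => if p ∣ D then 0 else (p : ℝ)⁻¹) m) ^ 3 ≤
      ∑ m ∈ Icc 1 (y * y * y), completelyMultiplicative x m := by
  set u : ℕ → ℝ := fun p => if p ∣ D then 0 else (p : ℝ)⁻¹ with hu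
  have hu0 : ∀ p, 0 ≤ u p := fun p => by rw [hu]; dsimp only; split_ifs <;> positivity
  have hu20 : ∀ p, 0 ≤ 2 * u p := fun p => mul_nonneg two_pos.le (hu0 p)
  have hn := completelyMultiplicative_nonneg hu0
  have hn2 := completelyMultiplicative_nonneg hu20
  have h1 := sum_mul_sum_le_sum (h := completelyMultiplicative fun p => 2 * u p) hn hn
    (fun p hp => by simp only [completelyMultiplicative_prime _ hp]; linarith) y y
  have h2 := sum_mul_sum_le_sum (h := completelyMultiplicative x) hn2 hn
    (fun p hp => by
      simp only [completelyMultiplicative_prime _ hp]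
      by_cases hpD : p ∣ D
      · simpa [hu, hpD] using hx0 p
      · have := hx p hp hpD
        simp only [hu, hpD, if_false]
        linarith) (y * y) y
  refine le_trans ?_ h2
  rw [pow_succ, sq]
  exact mul_le_mul_of_nonneg_right h1 (sum_nonneg fun m _ => hn m)

theorem sum_image_ite_card {α : Type*} (A : Finset α) (F : α → ℕ) (P : ℕ → Prop)
    [DecidablePred P] :
    ∑ n ∈ A.image F, (if P n then (#{q ∈ A | F q = n} : ℝ) else 0) = #{q ∈ A | P (F q)} := by
  rw [← sum_filter, ← Nat.cast_sum, card_eq_sum_card_fiberwise (f := F)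
    (t := (A.image F).filter P)]
  · congr 1
    refine sum_congr rfl fun n hn => ?_
    rw [filter_filter]
    congr 1
    refine filter_congr fun q _ => ?_
    exact ⟨fun h => ⟨h ▸ (mem_filter.1 hn).2, h⟩, fun h => h.2⟩
  · intro q hq
    have := mem_filter.1 hq
    exact mem_filter.2 ⟨mem_image_of_mem F this.1, this.2⟩

/-- The values `q * (r * q + 1) * (a - r * q)` for `q < Y`, sifted by the primes up to `z`. -/
noncomputable def tripletSieve (r a : ℤ) (Y z : ℕ)
    (h : ∀ p : ℕ, p.Prime → tripletRoots r a p < p) : BoundingSieve where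
  support := (range Y).image fun q : ℕ => ((q : ℤ) * (r * q + 1) * (a - r * q)).natAbs
  prodPrimes := primorial z
  prodPrimes_squarefree := by
    rw [primorial]
    refine Finset.squarefree_prod_of_pairwise_isCoprime ?_ ?_
    · intro p hp q hq hpq
      rw [Function.onFun, ← Nat.coprime_iff_isRelPrime]
      exact (Nat.coprime_primes (mem_filter.1 hp).2 (mem_filter.1 hq).2).2 hpq
    · exact fun p hp => (mem_filter.1 hp).2.prime.squarefree
  weights n := #((range Y).filter fun q : ℕ =>
    ((q : ℤ) * (r * q + 1) * (a - r * q)).natAbs = n)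
  weights_nonneg _ := Nat.cast_nonneg _
  totalMass := Y
  nu := ⟨fun d => tripletRoots r a d / d, by simp⟩
  nu_mult := by
    constructor
    · simp [tripletRoots_one]
    · intro m n hmn
      simp only [ArithmeticFunction.coe_mk]
      rw [tripletRoots_mul r a hmn]
      push_cast
      exact mul_div_mul_comm _ _ _ _
  nu_pos_of_prime p hp _ := by
    have h1 : (0 : ℝ) < tripletRoots r a p := by exact_mod_cast tripletRoots_pos r a hp.ne_zero
    have h2 : (0 : ℝ) < p := by exact_mod_cast hp.pos
    exact div_pos h1 h2
  nu_lt_one_of_prime p hp _ := by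
    have h2 : (0 : ℝ) < p := by exact_mod_cast hp.pos
    exact (div_lt_one h2).2 (by exact_mod_cast h p hp)

theorem card_coprime_triplet_le (r n : ℕ) (hr : 1 ≤ r) (hn : 3 ≤ n) (Y y : ℕ) (hy : 1 ≤ y)
    (h : ∀ p : ℕ, p.Prime → tripletRoots r ((n : ℤ) - 1) p < p) :
    (#((range Y).filter fun q : ℕ => (primorial (y * y * y)).Coprime
      ((q : ℤ) * (r * q + 1) * ((n : ℤ) - 1 - r * q)).natAbs) : ℝ) ≤
      Y * ((∏ p ∈ (r * (n - 1) * n).primeFactors, (1 - (p : ℝ)⁻¹)⁻¹) / Real.log (y + 1)) ^ 3 +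
        ((y : ℝ) ^ 3) ^ 6 := by
  set z := y * y * y with hz
  have hz1 : 1 ≤ z := by rw [hz]; exact Nat.mul_pos (Nat.mul_pos hy hy) hy
  set D := r * (n - 1) * n with hDdef
  have hD : D ≠ 0 := by
    rw [hDdef]
    exact mul_ne_zero (mul_ne_zero (by omega) (by omega)) (by omega)
  set a : ℤ := (n : ℤ) - 1 with ha
  set s := tripletSieve r a Y z h with hs
  have hnu : ∀ d, s.nu d = tripletRoots r a d / d := fun d => rfl
  have hP : s.prodPrimes = primorial z := rfl
  have hne : ∀ d, d ∣ s.prodPrimes → d ≠ 0 := fun d hd =>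
    ne_zero_of_dvd_ne_zero s.prodPrimes_ne_zero hd
  have hsift : s.siftedSum = #((range Y).filter fun q : ℕ => (primorial z).Coprime
      ((q : ℤ) * (r * q + 1) * (a - r * q)).natAbs) := by
    rw [BoundingSieve.siftedSum]
    exact sum_image_ite_card (range Y) (fun q : ℕ => ((q : ℤ) * (r * q + 1) * (a - r * q)).natAbs)
      fun m => (primorial z).Coprime m
  have hrem : ∀ d, d ∣ s.prodPrimes → |s.rem d| ≤ d := by
    intro d hd
    have h1 : s.multSum d = #((range Y).filter fun q : ℕ =>
        (d : ℤ) ∣ (q : ℤ) * (r * q + 1) * (a - r * q)) := by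
      rw [BoundingSieve.multSum]
      refine (sum_image_ite_card (range Y)
        (fun q : ℕ => ((q : ℤ) * (r * q + 1) * (a - r * q)).natAbs) fun m => d ∣ m).trans ?_
      simp only [Int.natCast_dvd]
    rw [BoundingSieve.rem, h1, hnu]
    refine (abs_card_dvd_triplet_sub_le r a (hne d hd) Y).trans ?_
    exact_mod_cast tripletRoots_le r a (hne d hd)
  have hnuinv : ∀ d, d ∣ s.prodPrimes → (s.nu d)⁻¹ ≤ d := by
    intro d hd
    have h1 : (1 : ℝ) ≤ tripletRoots r a d := by exact_mod_cast tripletRoots_pos r a (hne d hd)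
    rw [hnu, inv_div]
    exact div_le_self (Nat.cast_nonneg d) h1
  have hmain := s.siftedSum_le_selberg hz1 hnuinv hrem
  rw [hsift] at hmain
  refine hmain.trans ?_
  set M := ∏ p ∈ D.primeFactors, (1 - (p : ℝ)⁻¹)⁻¹ with hM
  have hMpos : 0 < M := prod_pos fun p hp => inv_pos.2 (sub_pos.2
    (inv_lt_one_of_one_lt₀ (by exact_mod_cast (Nat.prime_of_mem_primeFactors hp).one_lt)))
  have hlog : 0 < Real.log (y + 1) := Real.log_pos (by
    have : (1 : ℝ) ≤ y := by exact_mod_cast hy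
    linarith)
  have h0 : ∀ m, 0 ≤ s.nu m := fun m => by rw [hnu]; positivity
  have hG : (Real.log (y + 1) / M) ^ 3 ≤ s.selbergSum z := by
    refine le_trans ?_ (sum_completelyMultiplicative_nu_le_selbergSum s hP h0 fun p hp => ?_)
    · refine le_trans ?_ (pow_three_sum_le_sum (D := D) h0 (fun p hp hpD => ?_) y)
      · refine pow_le_pow_left₀ (by positivity) ?_ 3
        rw [div_le_iff₀ hMpos]
        exact log_le_sum_coprime_mul_prod hD y
      · rw [hnu, div_eq_mul_inv]
        refine mul_le_mul_of_nonneg_right ?_ (by positivity)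
        have : ¬ (p : ℤ) ∣ (r : ℤ) * a * (a + 1) := by
          intro hdvd
          apply hpD
          have e : (r : ℤ) * a * (a + 1) = (D : ℕ) := by
            rw [hDdef, ha]
            push_cast [Nat.cast_sub (show 1 ≤ n by omega)]
            ring
          rw [e] at hdvd
          exact_mod_cast hdvd
        exact_mod_cast three_le_tripletRoots hp this
    · rw [hnu, div_lt_one (by exact_mod_cast hp.pos)]
      exact_mod_cast h p hp
  have e1 : s.totalMass = Y := rfl
  have e2 : ((z : ℕ) : ℝ) = (y : ℝ) ^ 3 := by rw [hz]; push_cast; ring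
  rw [e1, e2]
  gcongr
  rw [div_eq_mul_inv]
  gcongr
  rw [← inv_div, inv_pow]
  exact inv_anti₀ (by positivity) hG

/-- The triples of primes in which one member lies in a given finite set. -/
theorem card_triplet_mem_le (N n r : ℕ) (hr : 1 ≤ r) (T : Finset ℕ) :
    #((range (N + 1)).filter fun q => (n - 1 - r * q).Prime ∧
      (q ∈ T ∨ r * q + 1 ∈ T ∨ n - 1 - r * q ∈ T)) ≤ 3 * #T := by
  set A := (range (N + 1)).filter fun q => (n - 1 - r * q).Prime
  have hsub : ((range (N + 1)).filter fun q => (n - 1 - r * q).Prime ∧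
      (q ∈ T ∨ r * q + 1 ∈ T ∨ n - 1 - r * q ∈ T)) ⊆
      (A.filter fun q => q ∈ T) ∪ ((A.filter fun q => r * q + 1 ∈ T) ∪
        A.filter fun q => n - 1 - r * q ∈ T) := by
    intro q hq
    simp only [A, mem_union, mem_filter] at hq ⊢
    tauto
  have h1 : #(A.filter fun q => q ∈ T) ≤ #T :=
    card_le_card fun q hq => (mem_filter.1 hq).2
  have h2 : #(A.filter fun q => r * q + 1 ∈ T) ≤ #T :=
    card_le_card_of_injOn (fun q => r * q + 1) (fun q hq => (mem_filter.1 hq).2)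
      fun q _ q' _ h => Nat.eq_of_mul_eq_mul_left hr (Nat.succ_injective h)
  have h3 : #(A.filter fun q => n - 1 - r * q ∈ T) ≤ #T := by
    refine card_le_card_of_injOn (fun q => n - 1 - r * q) (fun q hq => (mem_filter.1 hq).2) ?_
    intro q hq q' hq' h
    have a1 := (mem_filter.1 (mem_filter.1 hq).1).2.pos
    have a2 := (mem_filter.1 (mem_filter.1 hq').1).2.pos
    dsimp only at h
    exact Nat.eq_of_mul_eq_mul_left hr (by omega)
  have h4 := (card_le_card hsub).trans (card_union_le _ _)
  have h5 := card_union_le (A.filter fun q => r * q + 1 ∈ T) (A.filter fun q => n - 1 - r * q ∈ T)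
  omega

theorem card_prime_triplet_le (N n r : ℕ) (hr : 1 ≤ r) (hn : 3 ≤ n) (y : ℕ) (hy : 1 ≤ y) :
    (#((range (N + 1)).filter
      (fun q => q.Prime ∧ q * r ≤ N ∧ (r * q + 1).Prime ∧ (n - 1 - r * q).Prime)) : ℝ) ≤
      ((N / r : ℕ) + 1 : ℝ) *
        ((∏ p ∈ (r * (n - 1) * n).primeFactors, (1 - (p : ℝ)⁻¹)⁻¹) / Real.log (y + 1)) ^ 3 +
        4 * ((y : ℝ) ^ 3) ^ 6 := by
  have hy' : (1 : ℝ) ≤ y := by exact_mod_cast hy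
  have hlog : 0 < Real.log (y + 1) := Real.log_pos (by linarith)
  have hM : 0 ≤ ∏ p ∈ (r * (n - 1) * n).primeFactors, (1 - (p : ℝ)⁻¹)⁻¹ :=
    prod_nonneg fun p _ => inv_nonneg.2 (sub_nonneg.2 (Nat.cast_inv_le_one p))
  have hcast : ∀ q : ℕ, (n - 1 - r * q).Prime →
      ((q : ℤ) * (r * q + 1) * ((n : ℤ) - 1 - r * q)).natAbs = q * (r * q + 1) * (n - 1 - r * q) := by
    intro q hq
    have := hq.pos
    have e : ((n - 1 - r * q : ℕ) : ℤ) = (n : ℤ) - 1 - r * q := by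
      rw [Nat.cast_sub (by omega), Nat.cast_sub (by omega)]
      push_cast; ring
    rw [← e]
    have e2 : (q : ℤ) * (r * q + 1) * ((n - 1 - r * q : ℕ) : ℤ) =
      ((q * (r * q + 1) * (n - 1 - r * q) : ℕ) : ℤ) := by
        rw [Nat.cast_mul (q * (r * q + 1)), Nat.cast_mul q, Nat.cast_add, Nat.cast_mul r]
        rfl
    rw [e2, Int.natAbs_natCast]
  by_cases h : ∀ p : ℕ, p.Prime → tripletRoots r ((n : ℤ) - 1) p < p
  · have h1 := card_coprime_triplet_le r n hr hn (N / r + 1) y hy h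
    have h2 := card_triplet_mem_le N n r hr (Icc 1 (y * y * y))
    have hsub : (range (N + 1)).filter
        (fun q => q.Prime ∧ q * r ≤ N ∧ (r * q + 1).Prime ∧ (n - 1 - r * q).Prime) ⊆
        ((range (N / r + 1)).filter fun q : ℕ => (primorial (y * y * y)).Coprime
          ((q : ℤ) * (r * q + 1) * ((n : ℤ) - 1 - r * q)).natAbs) ∪
        (range (N + 1)).filter fun q => (n - 1 - r * q).Prime ∧
          (q ∈ Icc 1 (y * y * y) ∨ r * q + 1 ∈ Icc 1 (y * y * y) ∨
            n - 1 - r * q ∈ Icc 1 (y * y * y)) := by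
      intro q hq
      rw [mem_filter] at hq
      obtain ⟨hqN, hq1, hqr, hq2, hq3⟩ := hq
      rw [mem_union, mem_filter, mem_filter]
      by_cases hT : q ∈ Icc 1 (y * y * y) ∨ r * q + 1 ∈ Icc 1 (y * y * y) ∨
            n - 1 - r * q ∈ Icc 1 (y * y * y)
      · exact Or.inr ⟨hqN, hq3, hT⟩
      · left
        refine ⟨mem_range.2 (Nat.lt_succ_of_le ((Nat.le_div_iff_mul_le hr).2 hqr)), ?_⟩
        rw [hcast q hq3]
        have hcop : ∀ l : ℕ, l.Prime → l ∉ Icc 1 (y * y * y) → (primorial (y * y * y)).Coprime l := by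
          intro l hl hlz
          rw [Nat.coprime_comm, hl.coprime_iff_not_dvd, primorial, hl.prime.dvd_finsetProd_iff]
          rintro ⟨p, hp, hlp⟩
          rw [mem_filter, mem_range] at hp
          have := (Nat.prime_dvd_prime_iff_eq hl hp.2).1 hlp
          have := hl.pos
          exact hlz (mem_Icc.2 ⟨by omega, by omega⟩)
        simp only [not_or] at hT
        exact ((hcop q hq1 hT.1).mul_right (hcop _ hq2 hT.2.1)).mul_right (hcop _ hq3 hT.2.2)
    have h3 := (card_le_card hsub).trans (card_union_le _ _)
    have h4 : (y : ℝ) ^ 3 ≤ ((y : ℝ) ^ 3) ^ 6 := le_self_pow₀ (one_le_pow₀ hy') (by norm_num)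
    rw [Nat.card_Icc, Nat.add_sub_cancel] at h2
    have h2' : (#((range (N + 1)).filter fun q => (n - 1 - r * q).Prime ∧
          (q ∈ Icc 1 (y * y * y) ∨ r * q + 1 ∈ Icc 1 (y * y * y) ∨
            n - 1 - r * q ∈ Icc 1 (y * y * y))) : ℝ) ≤ 3 * (y : ℝ) ^ 3 := by
      have : ((y : ℝ)) ^ 3 = ((y * y * y : ℕ) : ℝ) := by push_cast; ring
      rw [this]
      exact_mod_cast h2
    have h3' := (Nat.cast_le (α := ℝ)).2 h3
    rw [Nat.cast_add] at h3'
    rw [Nat.cast_add, Nat.cast_one] at h1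
    linarith
  · simp only [not_forall, not_lt] at h
    obtain ⟨p, hp, hle⟩ := h
    have hdvd := dvd_triplet_of_tripletRoots_eq r ((n : ℤ) - 1) hp.ne_zero
      (le_antisymm (tripletRoots_le _ _ hp.ne_zero) hle)
    have hsub : (range (N + 1)).filter
        (fun q => q.Prime ∧ q * r ≤ N ∧ (r * q + 1).Prime ∧ (n - 1 - r * q).Prime) ⊆
        (range (N + 1)).filter fun q => (n - 1 - r * q).Prime ∧
          (q ∈ ({p} : Finset ℕ) ∨ r * q + 1 ∈ ({p} : Finset ℕ) ∨
            n - 1 - r * q ∈ ({p} : Finset ℕ)) := by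
      intro q hq
      rw [mem_filter] at hq ⊢
      obtain ⟨hqN, hq1, hqr, hq2, hq3⟩ := hq
      refine ⟨hqN, hq3, ?_⟩
      have hd := hdvd q
      rw [Int.natCast_dvd, hcast q hq3, hp.dvd_mul, hp.dvd_mul, Nat.prime_dvd_prime_iff_eq hp hq1,
        Nat.prime_dvd_prime_iff_eq hp hq2, Nat.prime_dvd_prime_iff_eq hp hq3] at hd
      simp only [mem_singleton]
      rcases hd with (hd | hd) | hd
      · exact Or.inl hd.symm
      · exact Or.inr (Or.inl hd.symm)
      · exact Or.inr (Or.inr hd.symm)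
    have h2 := (card_le_card hsub).trans (card_triplet_mem_le N n r hr {p})
    rw [card_singleton] at h2
    have h2' := (Nat.cast_le (α := ℝ)).2 h2
    have h4 : (1 : ℝ) ≤ ((y : ℝ) ^ 3) ^ 6 := one_le_pow₀ (one_le_pow₀ hy')
    have h5 : 0 ≤ ((N / r : ℕ) + 1 : ℝ) *
        ((∏ p ∈ (r * (n - 1) * n).primeFactors, (1 - (p : ℝ)⁻¹)⁻¹) / Real.log (y + 1)) ^ 3 := by
      positivity
    push_cast at h2'
    linarith


theorem eventually_log_conditions (x0 : ℕ) : ∃ N0 : ℕ, ∀ N : ℕ, N0 ≤ N →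
    4 ≤ Real.log N ∧ 1 ≤ Real.log (Real.log N) ∧ (x0 : ℝ) ≤ Real.log N ∧
      120 * Real.log (Real.log N) ^ 2 ≤ Real.log N := by
  have ht : Filter.Tendsto (fun N : ℕ => Real.log (N : ℝ)) Filter.atTop Filter.atTop :=
    Real.tendsto_log_atTop.comp tendsto_natCast_atTop_atTop
  have h1 : ∀ᶠ L : ℝ in Filter.atTop, 120 * Real.log L ^ 2 ≤ L := by
    have := (Real.isLittleO_pow_log_id_atTop (n := 2)).bound (show (0 : ℝ) < 1 / 120 by norm_num)
    filter_upwards [this, Filter.eventually_ge_atTop 0] with L hL h0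
    rw [Real.norm_of_nonneg (sq_nonneg _), id, Real.norm_of_nonneg h0] at hL
    linarith
  have h2 : ∀ᶠ L : ℝ in Filter.atTop,
      4 ≤ L ∧ 1 ≤ Real.log L ∧ (x0 : ℝ) ≤ L ∧ 120 * Real.log L ^ 2 ≤ L := by
    filter_upwards [h1, Filter.eventually_ge_atTop 4, Filter.eventually_ge_atTop (x0 : ℝ),
      Real.tendsto_log_atTop.eventually_ge_atTop 1] with L a b c d
    exact ⟨b, d, c, a⟩
  exact Filter.eventually_atTop.1 (ht.eventually h2)

theorem prod_primeFactors_le_log_log {C : ℝ} (hC : 0 < C) {x0 : ℕ}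
    (hprod : ∀ x ≥ x0, ∏ p ∈ Nat.primesLE x, (1 - (p : ℝ)⁻¹)⁻¹ ≤ C * Real.log x)
    {D : ℕ} (hD : D ≠ 0) {L : ℝ} (hL : 4 ≤ L) (hx0 : (x0 : ℝ) ≤ L) (hDL : Real.log D ≤ 3 * L) :
    ∏ p ∈ D.primeFactors, (1 - (p : ℝ)⁻¹)⁻¹ ≤ 2 * Real.exp 4 * C * Real.log L := by
  have hx : 3 * L ≤ ⌈3 * L⌉₊ := Nat.le_ceil _
  have hx4 : (⌈3 * L⌉₊ : ℝ) ≤ 4 * L := (Nat.ceil_lt_add_one (by linarith)).le.trans (by linarith)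
  have h0 : x0 ≤ ⌈3 * L⌉₊ := by
    have : (x0 : ℝ) ≤ ⌈3 * L⌉₊ := by linarith
    exact_mod_cast this
  have h2 : 2 ≤ ⌈3 * L⌉₊ := by
    have : (2 : ℝ) ≤ ⌈3 * L⌉₊ := by linarith
    exact_mod_cast this
  have hlog : Real.log (⌈3 * L⌉₊ : ℝ) ≤ 2 * Real.log L := by
    have h := Real.log_le_log (show (0 : ℝ) < ⌈3 * L⌉₊ by linarith)
      (hx4.trans (show 4 * L ≤ L ^ 2 by nlinarith))
    rwa [Real.log_pow, Nat.cast_ofNat] at h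
  calc _ ≤ Real.exp 4 * (C * Real.log (⌈3 * L⌉₊ : ℝ)) :=
        (prod_primeFactors_le hD h2 (hDL.trans hx)).trans (by gcongr; exact hprod _ h0)
    _ ≤ Real.exp 4 * (C * (2 * Real.log L)) := by gcongr
    _ = _ := by ring

theorem log_rpow_floor_bounds {X : ℝ} (hX : 1 ≤ X) :
    1 ≤ ⌊X ^ (36⁻¹ : ℝ)⌋₊ ∧ ((⌊X ^ (36⁻¹ : ℝ)⌋₊ : ℝ) ^ 3) ^ 6 ≤ Real.sqrt X ∧
      Real.log X / 36 ≤ Real.log (⌊X ^ (36⁻¹ : ℝ)⌋₊ + 1) := by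
  have h0 : 0 < X := by linarith
  refine ⟨Nat.le_floor ?_, ?_, ?_⟩
  · exact_mod_cast Real.one_le_rpow hX (by norm_num)
  · rw [← pow_mul]
    calc (⌊X ^ (36⁻¹ : ℝ)⌋₊ : ℝ) ^ (3 * 6) ≤ (X ^ (36⁻¹ : ℝ)) ^ (3 * 6) := by
          gcongr
          exact Nat.floor_le (by positivity)
      _ = Real.sqrt X := by
          rw [← Real.rpow_natCast, ← Real.rpow_mul h0.le, Real.sqrt_eq_rpow]
          norm_num
  · have h1 := Real.log_le_log (by positivity) (Nat.lt_floor_add_one (X ^ (36⁻¹ : ℝ))).le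
    rw [Real.log_rpow h0] at h1
    linarith

theorem sqrt_le_div_log_pow {X L l : ℝ} (hX : 0 < X) (hL : Real.exp l = L) (hl : 1 ≤ l)
    (hLl : 120 * l ^ 2 ≤ L) (hlog : L / (20 * l) ≤ Real.log X) :
    Real.sqrt X ≤ X * L⁻¹ ^ 3 := by
  have hL0 : 0 < L := hL ▸ Real.exp_pos l
  have h1 : L ^ 3 ≤ Real.sqrt X := by
    rw [← hL, ← Real.exp_nat_mul, ← Real.le_log_iff_exp_le (Real.sqrt_pos.2 hX),
      Real.log_sqrt hX.le]
    have : 6 * l ≤ L / (20 * l) := by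
      rw [le_div_iff₀ (by positivity)]
      linarith
    push_cast
    linarith
  rw [inv_pow, ← div_eq_mul_inv, le_div_iff₀ (by positivity)]
  calc Real.sqrt X * L ^ 3 ≤ Real.sqrt X * Real.sqrt X := by gcongr
    _ = X := Real.mul_self_sqrt hX.le

/-- for 3 ≤ n ≤ N and 1 ≤ r < N^{1 - 1/(20 log L)},
the number of primes q ≤ N/r such that rq + 1 and n - 1 - rq are both prime is
≪ (N/r) L^{-3} (log L)⁶, with an absolute implied constant. -/
theorem prime_triplet_linear_forms_count :
    ∃ C : ℝ, 0 < C ∧ ∃ N0 : ℕ,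
      ∀ N : ℕ, N0 ≤ N → ∀ n r : ℕ, 3 ≤ n → n ≤ N → 1 ≤ r →
        (r : ℝ) < (N : ℝ) ^ (1 - 1 / (20 * Real.log (Real.log N))) →
        (((Finset.range (N + 1)).filter
            (fun q => q.Prime ∧ q * r ≤ N ∧ (r * q + 1).Prime ∧ (n - 1 - r * q).Prime)).card : ℝ) ≤
          C * ((N : ℝ) / r) * (Real.log N)⁻¹ ^ 3 * Real.log (Real.log N) ^ 6 := by
  obtain ⟨C, hC, x0, hprod⟩ := exists_prod_primesLE_le
  obtain ⟨N0, hN0⟩ := eventually_log_conditions x0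
  set K := 2 * Real.exp 4 * C with hK
  have hK0 : 0 < K := by positivity
  refine ⟨2 * (720 * K) ^ 3 + 4, by positivity, N0, fun N hN n r hn hnN hr hrN => ?_⟩
  obtain ⟨hL4, hl1, hx0, hLl⟩ := hN0 N hN
  set L := Real.log N with hL
  set l := Real.log L with hl
  have hNpos : (0 : ℝ) < N := by
    have : 0 < N := by omega
    exact_mod_cast this
  have hr0 : (0 : ℝ) < r := by exact_mod_cast hr
  set X := (N : ℝ) / r with hX
  have hX0 : 0 < X := div_pos hNpos hr0
  have hlogX : L / (20 * l) ≤ Real.log X := by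
    have h1 := Real.log_lt_log hr0 hrN
    rw [Real.log_rpow hNpos] at h1
    rw [hX, Real.log_div hNpos.ne' hr0.ne']
    have e : (1 - 1 / (20 * l)) * L = L - L / (20 * l) := by ring
    rw [e] at h1
    linarith
  have hlogX0 : 0 < L / (20 * l) := by positivity
  have hX1 : 1 ≤ X := ((Real.log_pos_iff hX0.le).1 (hlogX0.trans_le hlogX)).le
  have hrN' : r ≤ N := by
    rw [hX, le_div_iff₀ hr0, one_mul] at hX1
    exact_mod_cast hX1
  obtain ⟨hy1, hy2, hy3⟩ := log_rpow_floor_bounds hX1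
  set y := ⌊X ^ (36⁻¹ : ℝ)⌋₊
  have hD : r * (n - 1) * n ≠ 0 :=
    mul_ne_zero (mul_ne_zero (by omega) (by omega)) (by omega)
  have hDL : Real.log (r * (n - 1) * n : ℕ) ≤ 3 * L := by
    have h1 : r * (n - 1) * n ≤ N ^ 3 := by
      rw [pow_succ, sq]
      exact Nat.mul_le_mul (Nat.mul_le_mul hrN' (by omega)) hnN
    have h2 := Real.log_le_log (by exact_mod_cast Nat.pos_of_ne_zero hD)
      ((Nat.cast_le (α := ℝ)).2 h1)
    rwa [Nat.cast_pow, Real.log_pow, Nat.cast_ofNat] at h2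
  have hM := prod_primeFactors_le_log_log hC hprod hD hL4 hx0 hDL
  rw [← hK, ← hl] at hM
  have hM0 : 0 ≤ ∏ p ∈ (r * (n - 1) * n).primeFactors, (1 - (p : ℝ)⁻¹)⁻¹ :=
    prod_nonneg fun p _ => inv_nonneg.2 (sub_nonneg.2 (Nat.cast_inv_le_one p))
  refine (card_prime_triplet_le N n r hr hn y hy1).trans ?_
  have hlogy : L / (720 * l) ≤ Real.log (y + 1) := by
    have e : L / (720 * l) = L / (20 * l) / 36 := by field_simp; norm_num
    linarith
  have hq0 : 0 ≤ (∏ p ∈ (r * (n - 1) * n).primeFactors, (1 - (p : ℝ)⁻¹)⁻¹) / Real.log (y + 1) :=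
    div_nonneg hM0 ((by positivity : 0 ≤ L / (720 * l)).trans hlogy)
  have hpow : ((∏ p ∈ (r * (n - 1) * n).primeFactors, (1 - (p : ℝ)⁻¹)⁻¹) / Real.log (y + 1)) ^ 3 ≤
      (720 * K) ^ 3 * (L⁻¹ ^ 3 * l ^ 6) := by
    calc _ ≤ (K * l / (L / (720 * l))) ^ 3 :=
          pow_le_pow_left₀ hq0 (div_le_div₀ (by positivity) hM (by positivity) hlogy) 3
      _ = _ := by field_simp
  have hfloor : ((N / r : ℕ) + 1 : ℝ) ≤ 2 * X := by
    have : ((N / r : ℕ) : ℝ) ≤ X := Nat.cast_div_le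
    linarith
  have hsq := sqrt_le_div_log_pow hX0 (Real.exp_log (by linarith)) hl1 hLl hlogX
  have hl6 : 1 ≤ l ^ 6 := one_le_pow₀ hl1
  calc _ ≤ 2 * X * ((720 * K) ^ 3 * (L⁻¹ ^ 3 * l ^ 6)) + 4 * (X * L⁻¹ ^ 3 * l ^ 6) := by
        refine add_le_add (mul_le_mul hfloor hpow (pow_nonneg hq0 3) (by positivity)) ?_
        refine mul_le_mul_of_nonneg_left ?_ (by norm_num)
        exact (hy2.trans hsq).trans (le_mul_of_one_le_right (by positivity) hl6)
    _ = _ := by ring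
end
end

section
/- Let c > 0 be a constant and N a sufficiently large odd integer, and set D = \sqrt{N} L^{-c}. Define Γ(N) = \sum_{d_1 \le D} \sum_{d_2 \le D} (χ(d_1) χ(d_2))/(φ(d_1) φ(d_2)) · \mathfrak{S}^{(3)}_{⟨d_1, d_2⟩, ⟨1, 1⟩}(N). Then for every ε > 0, Γ(N) = (1/16) \mathfrak{S}_R(N) + O(N^{ε - 1/100}), where the implied constant depends only on c and ε. -/
open Finset
open scoped Classical

noncomputable section

/-- The non-principal Dirichlet character modulo 4. -/
def chi4 (n : ℕ) : ℝ := if n % 4 = 1 then 1 else if n % 4 = 3 then -1 else 0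

/-- The Euler factor of the ternary Goldbach singular series 𝔖⁽³⁾(N). -/
def S3term (N p : ℕ) : ℝ :=
  if p ∣ N then 1 - 1 / ((p : ℝ) - 1) ^ 2 else 1 + 1 / ((p : ℝ) - 1) ^ 3

/-- The ternary Goldbach singular series 𝔖⁽³⁾(N). -/
def S3 (N : ℕ) : ℝ := ∏' p : Nat.Primes, S3term N (p : ℕ)

def SRterm1 (N p : ℕ) : ℝ :=
  if ¬ p ∣ N * (N - 1) * (N - 2) then
    1 + chi4 p * (2 * (p : ℝ) ^ 2 + (p : ℝ) * chi4 p - 6 * (p : ℝ) + 3 * chi4 p) /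
      ((p : ℝ) ^ 2 * ((p : ℝ) ^ 2 - 3 * (p : ℝ) + 3))
  else 1

def SRterm2 (N p : ℕ) : ℝ :=
  if p ∣ N then
    1 + chi4 p * (2 * (p : ℝ) ^ 2 + (p : ℝ) * chi4 p - 4 * (p : ℝ) + 2 * chi4 p) /
      ((p : ℝ) ^ 2 * ((p : ℝ) - 1) * ((p : ℝ) - 2))
  else 1

def SRterm3 (N p : ℕ) : ℝ :=
  if p ∣ N - 1 then
    1 + chi4 p * (4 * (p : ℝ) ^ 2 - (p : ℝ) * chi4 p - 6 * (p : ℝ) + 3 * chi4 p) /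
      ((p : ℝ) ^ 2 * ((p : ℝ) ^ 2 - 3 * (p : ℝ) + 3))
  else 1

def SRterm4 (N p : ℕ) : ℝ :=
  if p ∣ N - 2 then
    1 + chi4 p * (2 * (p : ℝ) ^ 2 - (p : ℝ) ^ 2 * chi4 p + (p : ℝ) * chi4 p - 6 * (p : ℝ) + 3 * chi4 p) /
      ((p : ℝ) ^ 2 * ((p : ℝ) ^ 2 - 3 * (p : ℝ) + 3))
  else 1

/-- The singular series 𝔖_R(N). -/
def SR (N : ℕ) : ℝ :=
  Real.pi ^ 2 * S3 N *
    (∏' p : Nat.Primes, SRterm1 N (p : ℕ)) *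
    (∏' p : Nat.Primes, SRterm2 N (p : ℕ)) *
    (∏' p : Nat.Primes, SRterm3 N (p : ℕ)) *
    (∏' p : Nat.Primes, SRterm4 N (p : ℕ))

/-- The Euler factor at p of the singular series 𝔖⁽³⁾_{⟨k₁,k₂⟩,⟨l₁,l₂⟩}(n)
(in the case where the set 𝓔 is empty). -/
def S3factor (k1 k2 : ℕ) (l1 l2 n : ℤ) (p : ℕ) : ℝ :=
  if p ∣ k1 then
    if p ∣ k2 then 1 + 1 / ((p : ℝ) - 1)
    else if (p : ℤ) ∣ n - l1 then 1 + 1 / ((p : ℝ) - 1) else 1 - 1 / ((p : ℝ) - 1) ^ 2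
  else if p ∣ k2 then
    if (p : ℤ) ∣ n - l2 then 1 + 1 / ((p : ℝ) - 1) else 1 - 1 / ((p : ℝ) - 1) ^ 2
  else if (p : ℤ) ∣ n then 1 - 1 / ((p : ℝ) - 1) ^ 2 else 1 + 1 / ((p : ℝ) - 1) ^ 3

/-- The singular series 𝔖⁽³⁾_{⟨k₁,k₂⟩,⟨l₁,l₂⟩}(n). -/
def S3kl (k1 k2 : ℕ) (l1 l2 n : ℤ) : ℝ :=
  if ∃ p : ℕ, p.Prime ∧ p ∣ k1 ∧ p ∣ k2 ∧ (p : ℤ) ∣ n - l1 - l2 then 0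
  else ∏' p : Nat.Primes, S3factor k1 k2 l1 l2 n (p : ℕ)

/-- Γ(N) = ∑_{d₁ ≤ D} ∑_{d₂ ≤ D} χ(d₁)χ(d₂)/(φ(d₁)φ(d₂)) · 𝔖⁽³⁾_{⟨d₁,d₂⟩,⟨1,1⟩}(N). -/
def Gam (N : ℕ) (D : ℝ) : ℝ :=
  ∑ d1 ∈ Finset.Icc 1 N, ∑ d2 ∈ Finset.Icc 1 N,
    if (d1 : ℝ) ≤ D ∧ (d2 : ℝ) ≤ D then
      chi4 d1 * chi4 d2 / ((Nat.totient d1 : ℝ) * (Nat.totient d2 : ℝ)) *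
        S3kl d1 d2 1 1 (N : ℤ)
    else 0

/-- The Euler factor at `p` of `S3kl d₁ d₂ 1 1 N`, as a function of the truth values of `p ∣ d₁`
and `p ∣ d₂`; it vanishes when both hold and `p ∣ N - 2`. -/
def locS (N p : ℕ) : Bool → Bool → ℝ
  | true, true => if p ∣ N - 2 then 0 else 1 + 1 / ((p : ℝ) - 1)
  | false, false => S3term N p
  | _, _ => if p ∣ N - 1 then 1 + 1 / ((p : ℝ) - 1) else 1 - 1 / ((p : ℝ) - 1) ^ 2

/-- The local factor `locS`, normalised by `S3term`, including the factors `p / (p - 1)` which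
come from Euler's totient function. -/
def locH (N p : ℕ) (i j : Bool) : ℝ :=
  ((p : ℝ) / (p - 1)) ^ i.toNat * ((p : ℝ) / (p - 1)) ^ j.toNat * (locS N p i j / S3term N p)

/-- The Möbius transform of `locH`. -/
def locG (N p : ℕ) : Bool → Bool → ℝ
  | true, true => locH N p true true - 2 * locH N p true false + 1
  | false, false => 1
  | _, _ => locH N p true false - 1

lemma chi4_mul (a b : ℕ) : chi4 (a * b) = chi4 a * chi4 b := by
  have ha : a % 4 < 4 := Nat.mod_lt _ (by norm_num)
  have hb : b % 4 < 4 := Nat.mod_lt _ (by norm_num)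
  unfold chi4
  rw [Nat.mul_mod]
  interval_cases a % 4 <;> interval_cases b % 4 <;> norm_num

lemma chi4_prod {ι : Type*} (s : Finset ι) (f : ι → ℕ) :
    chi4 (∏ i ∈ s, f i) = ∏ i ∈ s, chi4 (f i) := by
  induction s using Finset.induction_on with
  | empty => simp [chi4]
  | insert a s ha ih => rw [prod_insert ha, prod_insert ha, chi4_mul, ih]

lemma abs_chi4_le (n : ℕ) : |chi4 n| ≤ 1 := by
  unfold chi4
  split_ifs <;> norm_num

lemma two_le_prime_cast {p : ℕ} (hp : p.Prime) : (2 : ℝ) ≤ p := by exact_mod_cast hp.two_le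

lemma three_le_of_dvd_odd {N p : ℕ} (hp : p.Prime) (hN : Odd N) (h : p ∣ N) : (3 : ℝ) ≤ p := by
  have h2 : p ≠ 2 := by
    rintro rfl
    exact (Nat.not_even_iff_odd.2 hN) (even_iff_two_dvd.2 h)
  have := hp.two_le
  exact_mod_cast (by omega : 3 ≤ p)

lemma sq_sub_pos (x : ℝ) : 0 < x ^ 2 - 3 * x + 3 := by nlinarith [sq_nonneg (2 * x - 3)]

lemma S3term_of_dvd {N p : ℕ} (hp : p.Prime) (h : p ∣ N) :
    S3term N p = p * (p - 2) / ((p : ℝ) - 1) ^ 2 := by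
  have h2 := two_le_prime_cast hp
  have : (p : ℝ) - 1 ≠ 0 := by linarith
  rw [S3term, if_pos h]
  field_simp
  ring

lemma S3term_of_not_dvd {N p : ℕ} (hp : p.Prime) (h : ¬ p ∣ N) :
    S3term N p = p * ((p : ℝ) ^ 2 - 3 * p + 3) / ((p : ℝ) - 1) ^ 3 := by
  have h2 := two_le_prime_cast hp
  have : (p : ℝ) - 1 ≠ 0 := by linarith
  rw [S3term, if_neg h]
  field_simp
  ring

lemma S3term_pos {N p : ℕ} (hp : p.Prime) (hN : Odd N) : 0 < S3term N p := by
  have h2 := two_le_prime_cast hp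
  have h1 : 0 < (p : ℝ) - 1 := by linarith
  by_cases h : p ∣ N
  · have h3 := three_le_of_dvd_odd hp hN h
    have : 0 < (p : ℝ) - 2 := by linarith
    rw [S3term_of_dvd hp h]
    positivity
  · have := sq_sub_pos p
    rw [S3term_of_not_dvd hp h]
    positivity

lemma locH_tf (N p : ℕ) : locH N p true false = (p : ℝ) / (p - 1) *
    ((if p ∣ N - 1 then 1 + 1 / ((p : ℝ) - 1) else 1 - 1 / ((p : ℝ) - 1) ^ 2) / S3term N p) := by
  simp [locH, locS]

lemma locH_tt (N p : ℕ) : locH N p true true = ((p : ℝ) / (p - 1)) ^ 2 *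
    ((if p ∣ N - 2 then 0 else 1 + 1 / ((p : ℝ) - 1)) / S3term N p) := by
  simp [locH, locS, sq]

lemma locH_ff {N p : ℕ} (hp : p.Prime) (hN : Odd N) : locH N p false false = 1 := by
  simp [locH, locS, (S3term_pos hp hN).ne']

lemma not_dvd_sub_one {N p : ℕ} (hp : p.Prime) (hN3 : 3 ≤ N) (h : p ∣ N) : ¬ p ∣ N - 1 := by
  intro h1
  have := Nat.dvd_sub h h1
  rw [show N - (N - 1) = 1 by omega] at this
  exact hp.one_lt.ne' (Nat.dvd_one.1 this)

lemma not_dvd_sub_two {N p : ℕ} (hp : p.Prime) (hN3 : 3 ≤ N) (hN : Odd N) (h : p ∣ N) :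
    ¬ p ∣ N - 2 := by
  intro h1
  have h2 := Nat.dvd_sub h h1
  rw [show N - (N - 2) = 2 by omega] at h2
  have h3 : p = 2 := (Nat.prime_dvd_prime_iff_eq hp Nat.prime_two).1 h2
  have := three_le_of_dvd_odd hp hN h
  rw [h3] at this
  norm_num at this

lemma not_dvd_sub_two_of_sub_one {N p : ℕ} (hp : p.Prime) (hN3 : 3 ≤ N) (h : p ∣ N - 1) :
    ¬ p ∣ N - 2 := by
  intro h1
  have := Nat.dvd_sub h h1
  rw [show N - 1 - (N - 2) = 1 by omega] at this
  exact hp.one_lt.ne' (Nat.dvd_one.1 this)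

lemma locG_of_dvd {N p : ℕ} (hp : p.Prime) (hN3 : 3 ≤ N) (hN : Odd N) (h : p ∣ N) :
    locG N p true false = 1 / ((p : ℝ) - 1) ∧
      locG N p true true = ((p : ℝ) + 2) / ((p - 1) * (p - 2)) := by
  have h3 := three_le_of_dvd_odd hp hN h
  have ha : (p : ℝ) ≠ 0 := by linarith
  have hb : (p : ℝ) - 1 ≠ 0 := by linarith
  have hc : (p : ℝ) - 2 ≠ 0 := by linarith
  simp only [locG]
  rw [locH_tf, locH_tt, S3term_of_dvd hp h, if_neg (not_dvd_sub_one hp hN3 h),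
    if_neg (not_dvd_sub_two hp hN3 hN h)]
  constructor <;> field_simp <;> ring

lemma locG_of_dvd_sub_one {N p : ℕ} (hp : p.Prime) (hN3 : 3 ≤ N) (h : p ∣ N - 1) :
    locG N p true false = (2 * (p : ℝ) - 3) / ((p : ℝ) ^ 2 - 3 * p + 3) ∧
      locG N p true true = (3 - (p : ℝ)) / ((p : ℝ) ^ 2 - 3 * p + 3) := by
  have h2 := two_le_prime_cast hp
  have ha : (p : ℝ) ≠ 0 := by linarith
  have hb : (p : ℝ) - 1 ≠ 0 := by linarith
  have hc := (sq_sub_pos (p : ℝ)).ne'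
  simp only [locG]
  rw [locH_tf, locH_tt, S3term_of_not_dvd hp (fun h0 => not_dvd_sub_one hp hN3 h0 h), if_pos h,
    if_neg (not_dvd_sub_two_of_sub_one hp hN3 h)]
  generalize hQ : (p : ℝ) ^ 2 - 3 * p + 3 = Q at hc ⊢
  constructor <;> field_simp <;> subst hQ <;> ring

lemma locG_of_dvd_sub_two {N p : ℕ} (hp : p.Prime) (hN3 : 3 ≤ N) (hN : Odd N) (h : p ∣ N - 2) :
    locG N p true false = ((p : ℝ) - 3) / ((p : ℝ) ^ 2 - 3 * p + 3) ∧
      locG N p true true = (-(p : ℝ) ^ 2 + p + 3) / ((p : ℝ) ^ 2 - 3 * p + 3) := by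
  have h2 := two_le_prime_cast hp
  have ha : (p : ℝ) ≠ 0 := by linarith
  have hb : (p : ℝ) - 1 ≠ 0 := by linarith
  have hc := (sq_sub_pos (p : ℝ)).ne'
  simp only [locG]
  rw [locH_tf, locH_tt, S3term_of_not_dvd hp (fun h0 => not_dvd_sub_two hp hN3 hN h0 h), if_pos h,
    if_neg (fun h0 => not_dvd_sub_two_of_sub_one hp hN3 h0 h)]
  generalize hQ : (p : ℝ) ^ 2 - 3 * p + 3 = Q at hc ⊢
  constructor <;> field_simp <;> subst hQ <;> ring

lemma locG_of_not_dvd {N p : ℕ} (hp : p.Prime) (h0 : ¬ p ∣ N) (h1 : ¬ p ∣ N - 1)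
    (h2 : ¬ p ∣ N - 2) :
    locG N p true false = ((p : ℝ) - 3) / ((p : ℝ) ^ 2 - 3 * p + 3) ∧
      locG N p true true = ((p : ℝ) + 3) / ((p : ℝ) ^ 2 - 3 * p + 3) := by
  have hp2 := two_le_prime_cast hp
  have ha : (p : ℝ) ≠ 0 := by linarith
  have hb : (p : ℝ) - 1 ≠ 0 := by linarith
  have hc := (sq_sub_pos (p : ℝ)).ne'
  simp only [locG]
  rw [locH_tf, locH_tt, S3term_of_not_dvd hp h0, if_neg h1, if_neg h2]
  generalize hQ : (p : ℝ) ^ 2 - 3 * p + 3 = Q at hc ⊢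
  constructor <;> field_simp <;> subst hQ <;> ring

lemma locG_bounds {N p : ℕ} (hp : p.Prime) (hN3 : 3 ≤ N) (hN : Odd N) :
    |locG N p true false| ≤ 8 / p ∧ |locG N p true true| ≤ 8 := by
  have hp2 := two_le_prime_cast hp
  have hpos : (0 : ℝ) < p := by linarith
  have hc := sq_sub_pos (p : ℝ)
  have key : (p : ℝ) ^ 2 ≤ 4 * ((p : ℝ) ^ 2 - 3 * p + 3) := by nlinarith [sq_nonneg ((p : ℝ) - 2)]
  by_cases h0 : p ∣ N
  · obtain ⟨e1, e2⟩ := locG_of_dvd hp hN3 hN h0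
    have h3 := three_le_of_dvd_odd hp hN h0
    have ha : 0 < (p : ℝ) - 1 := by linarith
    have hb : 0 < (p : ℝ) - 2 := by linarith
    rw [e1, e2]
    constructor
    · rw [abs_of_pos (by positivity), div_le_div_iff₀ ha hpos]
      linarith
    · rw [abs_of_pos (by positivity), div_le_iff₀ (by positivity)]
      nlinarith
  by_cases h1 : p ∣ N - 1
  · obtain ⟨e1, e2⟩ := locG_of_dvd_sub_one hp hN3 h1
    rw [e1, e2]
    constructor
    · rw [abs_div, abs_of_pos hc, div_le_div_iff₀ hc hpos, abs_of_pos (by linarith)]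
      nlinarith
    · rw [abs_div, abs_of_pos hc, div_le_iff₀ hc, abs_le]
      constructor <;> nlinarith
  by_cases h2 : p ∣ N - 2
  · obtain ⟨e1, e2⟩ := locG_of_dvd_sub_two hp hN3 hN h2
    rw [e1, e2]
    constructor
    · have : |(p : ℝ) - 3| ≤ p := by rw [abs_le]; constructor <;> linarith
      rw [abs_div, abs_of_pos hc, div_le_div_iff₀ hc hpos]
      nlinarith
    · rw [abs_div, abs_of_pos hc, div_le_iff₀ hc, abs_le]
      constructor <;> nlinarith
  · obtain ⟨e1, e2⟩ := locG_of_not_dvd hp h0 h1 h2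
    rw [e1, e2]
    constructor
    · have : |(p : ℝ) - 3| ≤ p := by rw [abs_le]; constructor <;> linarith
      rw [abs_div, abs_of_pos hc, div_le_div_iff₀ hc hpos]
      nlinarith
    · rw [abs_div, abs_of_pos hc, div_le_iff₀ hc, abs_le]
      constructor <;> nlinarith

lemma SRterm_mul_eq {N p : ℕ} (hp : p.Prime) (hN3 : 3 ≤ N) (hN : Odd N) :
    SRterm1 N p * SRterm2 N p * SRterm3 N p * SRterm4 N p =
      (chi4 p / p) * (chi4 p / p) * locG N p true true + chi4 p / p * locG N p true false +
        chi4 p / p * locG N p true false + 1 := by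
  have hp2 := two_le_prime_cast hp
  have ha : (p : ℝ) ≠ 0 := by linarith
  have hc := (sq_sub_pos (p : ℝ)).ne'
  simp only [SRterm1, SRterm2, SRterm3, SRterm4, hp.dvd_mul]
  by_cases h0 : p ∣ N
  · obtain ⟨e1, e2⟩ := locG_of_dvd hp hN3 hN h0
    have h3 := three_le_of_dvd_odd hp hN h0
    have hb : (p : ℝ) - 1 ≠ 0 := by linarith
    have hd : (p : ℝ) - 2 ≠ 0 := by linarith
    simp only [h0, not_dvd_sub_one hp hN3 h0, not_dvd_sub_two hp hN3 hN h0, e1, e2, true_or,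
      not_true_eq_false, if_true, if_false]
    field_simp
    ring
  by_cases h1 : p ∣ N - 1
  · obtain ⟨e1, e2⟩ := locG_of_dvd_sub_one hp hN3 h1
    simp only [h0, h1, not_dvd_sub_two_of_sub_one hp hN3 h1, e1, e2, true_or, or_true,
      not_true_eq_false, if_true, if_false]
    field_simp
    ring
  by_cases h2 : p ∣ N - 2
  · obtain ⟨e1, e2⟩ := locG_of_dvd_sub_two hp hN3 hN h2
    simp only [h0, h1, h2, e1, e2, or_true, not_true_eq_false, if_true, if_false]
    field_simp
    ring
  · obtain ⟨e1, e2⟩ := locG_of_not_dvd hp h0 h1 h2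
    simp only [h0, h1, h2, e1, e2, or_self, not_false_eq_true, if_true, if_false]
    field_simp
    ring

lemma sum_chi4_div_eq (M : ℕ) :
    ∑ m ∈ Icc 1 M, chi4 m / m =
      ∑ i ∈ range ((M + 1) / 2), (-1 : ℝ) ^ i * (1 / (2 * (i : ℝ) + 1)) := by
  induction M with
  | zero => simp
  | succ M ih =>
    rw [sum_Icc_succ_top (by omega), ih]
    rcases Nat.even_or_odd' M with ⟨k, rfl | rfl⟩
    · rw [show (2 * k + 1) / 2 = k by omega, show (2 * k + 1 + 1) / 2 = k + 1 by omega,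
        sum_range_succ]
      congr 1
      have hchi : chi4 (2 * k + 1) = (-1) ^ k := by
        unfold chi4
        rcases Nat.even_or_odd' k with ⟨j, rfl | rfl⟩
        · rw [if_pos (by omega)]
          simp
        · rw [if_neg (by omega), if_pos (by omega)]
          simp [pow_succ]
      rw [hchi]
      push_cast
      ring
    · rw [show (2 * k + 1 + 1) / 2 = k + 1 by omega,
        show (2 * k + 1 + 1 + 1) / 2 = k + 1 by omega]
      have hchi : chi4 (2 * k + 1 + 1) = 0 := by
        unfold chi4
        rw [if_neg (by omega), if_neg (by omega)]
      simp [hchi]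

lemma abs_sum_chi4_div_sub_le (M : ℕ) :
    |∑ m ∈ Icc 1 M, chi4 m / m - Real.pi / 4| ≤ 1 / ((M : ℝ) + 1) := by
  have hanti : Antitone (fun i : ℕ => 1 / (2 * (i : ℝ) + 1)) := by
    intro a b hab
    have : (a : ℝ) ≤ b := by exact_mod_cast hab
    apply one_div_le_one_div_of_le <;> [positivity; linarith]
  have ht : Filter.Tendsto
      (fun n => ∑ i ∈ range n, (-1 : ℝ) ^ i * (fun i : ℕ => 1 / (2 * (i : ℝ) + 1)) i)
      Filter.atTop (nhds (Real.pi / 4)) := by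
    simpa [div_eq_mul_inv] using Real.tendsto_sum_pi_div_four
  have bound : ∀ k : ℕ, |∑ i ∈ range k, (-1 : ℝ) ^ i * (1 / (2 * (i : ℝ) + 1)) - Real.pi / 4| ≤
      1 / (2 * (k : ℝ) + 1) := by
    intro k
    rcases Nat.even_or_odd' k with ⟨j, rfl | rfl⟩
    · have h1 := hanti.alternating_series_le_tendsto ht j
      have h2 := hanti.tendsto_le_alternating_series ht j
      rw [sum_range_succ] at h2
      simp only [even_two, Even.mul_right, Even.neg_pow, one_pow, one_mul] at h1 h2
      rw [abs_le]
      constructor <;> linarith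
    · have h1 := hanti.alternating_series_le_tendsto ht (j + 1)
      have h2 := hanti.tendsto_le_alternating_series ht j
      rw [show 2 * (j + 1) = 2 * j + 1 + 1 by ring, sum_range_succ] at h1
      rw [show (-1 : ℝ) ^ (2 * j + 1) = -1 by simp [pow_succ]] at h1
      rw [abs_le]
      constructor <;> linarith
  rw [sum_chi4_div_eq]
  refine (bound _).trans (one_div_le_one_div_of_le (by positivity) ?_)
  have : M ≤ 2 * ((M + 1) / 2) := by omega
  have : (M : ℝ) ≤ 2 * (((M + 1) / 2 : ℕ) : ℝ) := by exact_mod_cast this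
  linarith

lemma sum_chi4_div_of_dvd (M e : ℕ) (he : 0 < e) :
    ∑ d ∈ Icc 1 M, (if e ∣ d then chi4 d / d else 0) =
      chi4 e / e * ∑ m ∈ Icc 1 (M / e), chi4 m / m := by
  rw [← sum_filter, mul_sum]
  symm
  refine sum_bij (fun m _ => e * m) ?_ ?_ ?_ ?_
  · intro m hm
    rw [mem_Icc] at hm
    rw [mem_filter, mem_Icc]
    refine ⟨⟨Nat.mul_pos he hm.1, ?_⟩, dvd_mul_right _ _⟩
    exact (Nat.mul_le_mul_left e hm.2).trans (Nat.mul_div_le M e)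
  · intro a _ b _ hab
    exact Nat.eq_of_mul_eq_mul_left he hab
  · intro d hd
    rw [mem_filter, mem_Icc] at hd
    obtain ⟨⟨h1, h2⟩, m, rfl⟩ := hd
    refine ⟨m, ?_, rfl⟩
    rw [mem_Icc]
    refine ⟨Nat.pos_of_mul_pos_left h1, ?_⟩
    rw [Nat.le_div_iff_mul_le he, mul_comm]
    exact h2
  · intro m _
    rw [chi4_mul]
    push_cast
    exact div_mul_div_comm _ _ _ _

lemma abs_sum_chi4_div_of_dvd_sub_le {D : ℝ} (hD : 0 < D) {e : ℕ} (he : 0 < e) :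
    |∑ d ∈ Icc 1 ⌊D⌋₊, (if e ∣ d then chi4 d / d else 0) - chi4 e / e * (Real.pi / 4)| ≤
        D ^ (-(1 / 4) : ℝ) * (e : ℝ) ^ (-(3 / 4) : ℝ) ∧
      |∑ d ∈ Icc 1 ⌊D⌋₊, (if e ∣ d then chi4 d / d else 0) - chi4 e / e * (Real.pi / 4)| ≤
        (e : ℝ) ^ (-(3 / 4) : ℝ) := by
  have he' : (0 : ℝ) < e := by exact_mod_cast he
  have he1 : (1 : ℝ) ≤ e := by exact_mod_cast he
  rw [sum_chi4_div_of_dvd _ _ he, ← mul_sub, abs_mul, abs_div, abs_of_pos he',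
    ← Nat.floor_div_natCast]
  set M := ⌊D / (e : ℝ)⌋₊ with hM
  have h1 := abs_sum_chi4_div_sub_le M
  set S := |∑ m ∈ Icc 1 M, chi4 m / m - Real.pi / 4|
  have hS0 : 0 ≤ S := abs_nonneg _
  have hS1 : S ≤ 1 := h1.trans (by
    rw [div_le_one (by positivity)]
    linarith [Nat.cast_nonneg (α := ℝ) M])
  have hS2 : S ≤ (D / e)⁻¹ := h1.trans (by
    rw [one_div]
    exact inv_anti₀ (by positivity) (Nat.lt_floor_add_one _).le)
  have hS3 : S ≤ ((D / e)⁻¹) ^ (1 / 4 : ℝ) := by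
    calc S = S ^ (1 : ℝ) := (Real.rpow_one S).symm
      _ ≤ S ^ (1 / 4 : ℝ) := Real.rpow_le_rpow_of_exponent_ge' hS0 hS1 (by norm_num) (by norm_num)
      _ ≤ _ := Real.rpow_le_rpow hS0 hS2 (by norm_num)
  have hchi : |chi4 e| / e ≤ (e : ℝ) ^ (-1 : ℝ) := by
    rw [Real.rpow_neg_one, ← one_div]
    gcongr
    exact abs_chi4_le e
  constructor
  · calc |chi4 e| / e * S ≤ (e : ℝ) ^ (-1 : ℝ) * ((D / e)⁻¹) ^ (1 / 4 : ℝ) := by gcongr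
      _ = D ^ (-(1 / 4) : ℝ) * (e : ℝ) ^ (-(3 / 4) : ℝ) := by
        rw [inv_div, Real.div_rpow he'.le hD.le, Real.rpow_neg hD.le,
          show (-(3 / 4) : ℝ) = -1 + 1 / 4 by norm_num, Real.rpow_add he']
        ring
  · calc |chi4 e| / e * S ≤ (e : ℝ) ^ (-1 : ℝ) * 1 := by gcongr
      _ ≤ _ := by
        rw [mul_one]
        exact Real.rpow_le_rpow_of_exponent_le he1 (by norm_num)

lemma sum_powerset_prod_bool {ι R : Type*} [DecidableEq ι] [CommSemiring R] (P : Finset ι)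
    (w : ι → Bool → Bool → R) :
    ∑ A ∈ P.powerset, ∑ B ∈ P.powerset, ∏ p ∈ P, w p (decide (p ∈ A)) (decide (p ∈ B)) =
      ∏ p ∈ P, (w p true true + w p true false + w p false true + w p false false) := by
  induction P using Finset.induction_on with
  | empty => simp
  | insert a s ha ih =>
    have hA : ∀ A ∈ s.powerset, a ∉ A := fun A hA h => ha (mem_powerset.1 hA h)
    have hs : ∀ A B A' B' : Finset ι, (∀ p ∈ s, (p ∈ A ↔ p ∈ A')) → (∀ p ∈ s, (p ∈ B ↔ p ∈ B')) →
        ∏ p ∈ s, w p (decide (p ∈ A)) (decide (p ∈ B)) =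
          ∏ p ∈ s, w p (decide (p ∈ A')) (decide (p ∈ B')) := by
      intro A B A' B' h1 h2
      refine prod_congr rfl fun p hp => ?_
      simp only [h1 p hp, h2 p hp]
    have hins : ∀ A : Finset ι, ∀ p ∈ s, (p ∈ insert a A ↔ p ∈ A) := by
      intro A p hp
      rw [mem_insert]
      exact or_iff_right (fun h => ha (h ▸ hp))
    simp only [sum_powerset_insert ha, prod_insert ha]
    rw [← ih, ← sum_add_distrib, mul_sum]
    refine sum_congr rfl fun A hAm => ?_
    rw [← sum_add_distrib, ← sum_add_distrib, ← sum_add_distrib, mul_sum]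
    refine sum_congr rfl fun B hBm => ?_
    rw [hs A (insert a B) A B (fun _ _ => Iff.rfl) (hins B),
      hs (insert a A) B A B (hins A) (fun _ _ => Iff.rfl),
      hs (insert a A) (insert a B) A B (hins A) (hins B)]
    simp only [hA A hAm, hA B hBm, mem_insert_self, decide_true, decide_false]
    ring

lemma sum_powerset_prod_weights {ι : Type*} [DecidableEq ι] (P : Finset ι) (W : ι → Bool → Bool → ℝ)
    (x y : ι → ℝ) :
    ∑ A ∈ P.powerset, ∑ B ∈ P.powerset,
        (∏ p ∈ P, W p (decide (p ∈ A)) (decide (p ∈ B))) * ((∏ p ∈ A, x p) * ∏ p ∈ B, y p) =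
      ∏ p ∈ P, (x p * y p * W p true true + x p * W p true false + y p * W p false true +
        W p false false) := by
  have h := sum_powerset_prod_bool P
    (fun p i j => W p i j * ((if i then x p else 1) * (if j then y p else 1)))
  have hz : ∀ (z : ι → ℝ), ∀ A ∈ P.powerset,
      ∏ p ∈ P, (if decide (p ∈ A) = true then z p else 1) = ∏ p ∈ A, z p := by
    intro z A hA
    simp only [decide_eq_true_eq]
    rw [prod_ite_mem, inter_eq_right.2 (mem_powerset.1 hA)]
  rw [prod_congr rfl (g := fun p => W p true true * ((if true then x p else 1) *
    (if true then y p else 1)) + W p true false * ((if true then x p else 1) *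
    (if false then y p else 1)) + W p false true * ((if false then x p else 1) *
    (if true then y p else 1)) + W p false false * ((if false then x p else 1) *
    (if false then y p else 1))) (fun p _ => by simp; ring), ← h]
  refine sum_congr rfl fun A hA => sum_congr rfl fun B hB => ?_
  rw [prod_mul_distrib, prod_mul_distrib, hz x A hA, hz y B hB]

lemma prod_primes_dvd_iff (A : Finset Nat.Primes) (d : ℕ) :
    ∏ p ∈ A, (p : ℕ) ∣ d ↔ ∀ p ∈ A, (p : ℕ) ∣ d := by
  constructor
  · exact fun h p hp => (dvd_prod_of_mem _ hp).trans h
  · intro h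
    refine prod_dvd_of_isRelPrime (fun p _ q _ hpq => ?_) h
    exact Nat.coprime_iff_isRelPrime.1
      ((Nat.coprime_primes p.2 q.2).2 fun hc => hpq (Subtype.ext hc))

lemma prod_ite_dvd_one_zero (A : Finset Nat.Primes) (d : ℕ) :
    ∏ p ∈ A, (if (p : ℕ) ∣ d then (1 : ℝ) else 0) = if ∏ p ∈ A, (p : ℕ) ∣ d then 1 else 0 := by
  split_ifs with h
  · exact prod_eq_one fun p hp => if_pos ((prod_primes_dvd_iff A d).1 h p hp)
  · rw [prod_primes_dvd_iff] at h
    push Not at h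
    obtain ⟨p, hp, hpd⟩ := h
    exact prod_eq_zero hp (if_neg hpd)

lemma prod_locH_eq {N : ℕ} (hN : Odd N) (P : Finset Nat.Primes) (d1 d2 : ℕ) :
    ∏ p ∈ P, locH N p (decide ((p : ℕ) ∣ d1)) (decide ((p : ℕ) ∣ d2)) =
      ∑ A ∈ P.powerset, ∑ B ∈ P.powerset,
        (∏ p ∈ P, locG N p (decide (p ∈ A)) (decide (p ∈ B))) *
          ((if ∏ p ∈ A, (p : ℕ) ∣ d1 then 1 else 0) *
            (if ∏ p ∈ B, (p : ℕ) ∣ d2 then 1 else 0)) := by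
  have h := sum_powerset_prod_weights P (fun p i j => locG N p i j)
    (fun p => if (p : ℕ) ∣ d1 then 1 else 0) (fun p => if (p : ℕ) ∣ d2 then 1 else 0)
  simp only [prod_ite_dvd_one_zero] at h
  rw [h]
  refine prod_congr rfl fun p _ => ?_
  have hsymm : locH N p false true = locH N p true false := by simp [locH, locS]
  by_cases h1 : (p : ℕ) ∣ d1 <;> by_cases h2 : (p : ℕ) ∣ d2 <;>
    simp only [h1, h2, locG, decide_true, decide_false, if_true, if_false, hsymm,
      locH_ff p.2 hN] <;> ring

lemma prod_ite_dvd_eq {N d : ℕ} {P : Finset Nat.Primes}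
    (hP : ∀ p : Nat.Primes, (p : ℕ) ≤ N → p ∈ P) (hd : d ∈ Icc 1 N) (f : ℕ → ℝ) :
    ∏ p ∈ P, (if (p : ℕ) ∣ d then f p else 1) = ∏ p ∈ d.primeFactors, f p := by
  rw [mem_Icc] at hd
  rw [← prod_filter]
  refine prod_bij (fun p _ => (p : ℕ)) ?_ ?_ ?_ ?_
  · intro p hp
    exact Nat.mem_primeFactors.2 ⟨p.2, (mem_filter.1 hp).2, by omega⟩
  · intro a _ b _ hab
    exact Subtype.ext hab
  · intro p hp
    obtain ⟨hp1, hp2, _⟩ := Nat.mem_primeFactors.1 hp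
    exact ⟨⟨p, hp1⟩, mem_filter.2 ⟨hP ⟨p, hp1⟩ ((Nat.le_of_dvd hd.1 hp2).trans hd.2), hp2⟩, rfl⟩
  · intro p _
    rfl

lemma prod_totient_factor {N d : ℕ} {P : Finset Nat.Primes}
    (hP : ∀ p : Nat.Primes, (p : ℕ) ≤ N → p ∈ P) (hd : d ∈ Icc 1 N) :
    ∏ p ∈ P, ((p : ℝ) / ((p : ℝ) - 1)) ^ (decide ((p : ℕ) ∣ d)).toNat = d / Nat.totient d := by
  have h1 : ∏ p ∈ P, ((p : ℝ) / ((p : ℝ) - 1)) ^ (decide ((p : ℕ) ∣ d)).toNat =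
      ∏ p ∈ P, (if (p : ℕ) ∣ d then (fun n : ℕ => (n : ℝ) / ((n : ℝ) - 1)) p else 1) := by
    refine prod_congr rfl fun p _ => ?_
    by_cases h : (p : ℕ) ∣ d <;> simp [h]
  rw [h1, prod_ite_dvd_eq hP hd fun n : ℕ => (n : ℝ) / ((n : ℝ) - 1)]
  have hd0 : (d : ℝ) ≠ 0 := by
    rw [mem_Icc] at hd
    exact_mod_cast (by omega : d ≠ 0)
  have h2 : (Nat.totient d : ℝ) = d * ∏ p ∈ d.primeFactors, (1 - ((p : ℝ))⁻¹) := by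
    have := congrArg (fun q : ℚ => (q : ℝ)) (Nat.totient_eq_mul_prod_factors d)
    simpa using this
  have h3 : ∏ p ∈ d.primeFactors, (p : ℝ) / ((p : ℝ) - 1) =
      (∏ p ∈ d.primeFactors, (1 - ((p : ℝ))⁻¹))⁻¹ := by
    rw [← prod_inv_distrib]
    refine prod_congr rfl fun p hp => ?_
    have := two_le_prime_cast (Nat.prime_of_mem_primeFactors hp)
    have h0 : (p : ℝ) ≠ 0 := by linarith
    rw [← one_div_div, ← one_div]
    congr 1
    field_simp
  rw [h3, h2, div_mul_eq_div_div, div_self hd0, one_div]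

lemma one_div_sq_le_rpow {x : ℝ} (hx : 1 ≤ x) : 1 / x ^ 2 ≤ x ^ (-(3 / 2) : ℝ) := by
  have : 1 / x ^ 2 = x ^ (-2 : ℝ) := by
    rw [Real.rpow_neg (by linarith), one_div]
    norm_num
  rw [this]
  exact Real.rpow_le_rpow_of_exponent_le hx (by norm_num)

lemma summable_primes_rpow : Summable fun p : Nat.Primes => ((p : ℕ) : ℝ) ^ (-(3 / 2) : ℝ) :=
  Nat.Primes.summable_rpow.2 (by norm_num)

lemma multipliable_of_abs_sub_one_le {f : Nat.Primes → ℝ} {K : ℝ}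
    (h : ∀ p : Nat.Primes, |f p - 1| ≤ K * (1 / (p : ℝ) ^ 2)) (hK : 0 ≤ K) : Multipliable f := by
  have hs : Summable fun p => f p - 1 := by
    refine Summable.of_norm_bounded (summable_primes_rpow.mul_left K) fun p => ?_
    refine (h p).trans (mul_le_mul_of_nonneg_left (one_div_sq_le_rpow ?_) hK)
    linarith [two_le_prime_cast p.2]
  simpa using Real.multipliable_one_add_of_summable hs

lemma prod_primes_le_exp {f : Nat.Primes → ℝ} {K : ℝ} (hK : 0 ≤ K) (P : Finset Nat.Primes)
    (h0 : ∀ p, 0 ≤ f p) (h : ∀ p : Nat.Primes, f p ≤ 1 + K * (p : ℝ) ^ (-(3 / 2) : ℝ)) :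
    ∏ p ∈ P, f p ≤ Real.exp (K * ∑' p : Nat.Primes, (p : ℝ) ^ (-(3 / 2) : ℝ)) := by
  calc ∏ p ∈ P, f p ≤ ∏ p ∈ P, Real.exp (K * (p : ℝ) ^ (-(3 / 2) : ℝ)) := by
        refine prod_le_prod (fun p _ => h0 p) fun p _ => (h p).trans ?_
        rw [add_comm]
        exact Real.add_one_le_exp _
    _ = Real.exp (K * ∑ p ∈ P, (p : ℝ) ^ (-(3 / 2) : ℝ)) := by
        rw [← Real.exp_sum, mul_sum]
    _ ≤ _ := by
        refine Real.exp_le_exp.2 (mul_le_mul_of_nonneg_left ?_ hK)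
        exact summable_primes_rpow.sum_le_tsum _ fun p _ => by positivity

lemma abs_S3term_sub_one_le (N : ℕ) {p : ℕ} (hp : p.Prime) :
    |S3term N p - 1| ≤ 4 * (1 / (p : ℝ) ^ 2) := by
  have h2 := two_le_prime_cast hp
  have h1 : 1 ≤ (p : ℝ) - 1 := by linarith
  have hsq : 1 / ((p : ℝ) - 1) ^ 2 ≤ 4 * (1 / (p : ℝ) ^ 2) := by
    rw [mul_one_div, div_le_div_iff₀ (by positivity) (by positivity)]
    nlinarith
  unfold S3term
  split_ifs
  · rw [show (1 - 1 / ((p : ℝ) - 1) ^ 2 - 1) = -(1 / ((p : ℝ) - 1) ^ 2) by ring, abs_neg,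
      abs_of_nonneg (by positivity)]
    exact hsq
  · rw [add_sub_cancel_left, abs_of_nonneg (by positivity)]
    refine le_trans ?_ hsq
    exact one_div_le_one_div_of_le (by positivity) (pow_le_pow_right₀ h1 (by norm_num))

lemma multipliable_S3term (N : ℕ) : Multipliable fun p : Nat.Primes => S3term N p :=
  multipliable_of_abs_sub_one_le (fun p => abs_S3term_sub_one_le N p.2) (by norm_num)

lemma abs_S3_le {N : ℕ} (hN : Odd N) :
    |S3 N| ≤ Real.exp (4 * ∑' p : Nat.Primes, (p : ℝ) ^ (-(3 / 2) : ℝ)) := by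
  have hp : Filter.Tendsto (fun P : Finset Nat.Primes => ∏ p ∈ P, S3term N p) Filter.atTop
      (nhds (S3 N)) := (multipliable_S3term N).hasProd
  have h0 : ∀ p : Nat.Primes, 0 ≤ S3term N p := fun p => (S3term_pos p.2 hN).le
  rw [abs_of_nonneg (ge_of_tendsto' hp fun P => prod_nonneg fun p _ => h0 p)]
  refine le_of_tendsto' hp fun P => prod_primes_le_exp (by norm_num) P h0 fun p => ?_
  have h1 := (abs_le.1 (abs_S3term_sub_one_le N p.2)).2
  have h2 := one_div_sq_le_rpow (x := (p : ℝ)) (by linarith [two_le_prime_cast p.2])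
  linarith

lemma int_dvd_sub_cast {N p k : ℕ} (hk : k ≤ N) : (p : ℤ) ∣ (N : ℤ) - k ↔ p ∣ N - k := by
  rw [← Nat.cast_sub hk, Int.natCast_dvd_natCast]

lemma S3kl_eq {N d1 d2 : ℕ} (hN3 : 3 ≤ N) (hN : Odd N) {P : Finset Nat.Primes}
    (hP : ∀ p : Nat.Primes, (p : ℕ) ≤ N → p ∈ P) (hd1 : d1 ∈ Icc 1 N) (hd2 : d2 ∈ Icc 1 N) :
    S3kl d1 d2 1 1 N = S3 N * ∏ p ∈ P,
      (locS N p (decide ((p : ℕ) ∣ d1)) (decide ((p : ℕ) ∣ d2)) / S3term N p) := by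
  have hs1 : ∀ p : ℕ, (p : ℤ) ∣ (N : ℤ) - 1 ↔ p ∣ N - 1 := fun p => by
    exact_mod_cast int_dvd_sub_cast (p := p) (by omega : 1 ≤ N)
  have hs2 : ∀ p : ℕ, (p : ℤ) ∣ (N : ℤ) - 1 - 1 ↔ p ∣ N - 2 := fun p => by
    rw [show (N : ℤ) - 1 - 1 = (N : ℤ) - (2 : ℕ) by push_cast; ring]
    exact int_dvd_sub_cast (by omega)
  rw [mem_Icc] at hd1 hd2
  unfold S3kl
  split_ifs with h
  · obtain ⟨p, hp, h1, h2, h3⟩ := h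
    rw [prod_eq_zero (hP ⟨p, hp⟩ ((Nat.le_of_dvd hd1.1 h1).trans hd1.2)), mul_zero]
    simp [h1, h2, locS, (hs2 p).1 h3]
  · have hfac : ∀ p : Nat.Primes, S3factor d1 d2 1 1 N p = S3term N p *
        (locS N p (decide ((p : ℕ) ∣ d1)) (decide ((p : ℕ) ∣ d2)) / S3term N p) := by
      intro p
      rw [mul_div_cancel₀ _ (S3term_pos p.2 hN).ne']
      have hp := fun h1 h2 h3 => h ⟨p, p.2, h1, h2, (hs2 p).2 h3⟩
      by_cases h1 : (p : ℕ) ∣ d1 <;> by_cases h2 : (p : ℕ) ∣ d2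
      · have h3 : ¬ (p : ℕ) ∣ N - 2 := hp h1 h2
        simp only [S3factor, locS, h1, h2, h3, decide_true, if_true, if_false]
      all_goals simp [S3factor, locS, S3term, h1, h2, hs1, Int.natCast_dvd_natCast]
    have hone : ∀ p ∉ P,
        locS N p (decide ((p : ℕ) ∣ d1)) (decide ((p : ℕ) ∣ d2)) / S3term N p = 1 := by
      intro p hp
      have h1 : ¬ (p : ℕ) ∣ d1 := fun h1 => hp (hP p ((Nat.le_of_dvd hd1.1 h1).trans hd1.2))
      have h2 : ¬ (p : ℕ) ∣ d2 := fun h2 => hp (hP p ((Nat.le_of_dvd hd2.1 h2).trans hd2.2))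
      simp [h1, h2, locS, (S3term_pos p.2 hN).ne']
    rw [tprod_congr hfac, Multipliable.tprod_mul (multipliable_S3term N)
      (multipliable_of_hasFiniteMulSupport
        (P.finite_toSet.subset fun p hp => by_contra fun hq => hp (hone p hq))),
      tprod_eq_prod hone, S3]

lemma S3kl_div_totient_eq {N d1 d2 : ℕ} (hN3 : 3 ≤ N) (hN : Odd N) {P : Finset Nat.Primes}
    (hP : ∀ p : Nat.Primes, (p : ℕ) ≤ N → p ∈ P) (hd1 : d1 ∈ Icc 1 N) (hd2 : d2 ∈ Icc 1 N) :
    chi4 d1 * chi4 d2 / ((Nat.totient d1 : ℝ) * (Nat.totient d2 : ℝ)) * S3kl d1 d2 1 1 N =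
      S3 N * ((chi4 d1 / d1) * (chi4 d2 / d2) *
        ∏ p ∈ P, locH N p (decide ((p : ℕ) ∣ d1)) (decide ((p : ℕ) ∣ d2))) := by
  simp only [locH]
  rw [prod_mul_distrib, prod_mul_distrib, prod_totient_factor hP hd1, prod_totient_factor hP hd2,
    S3kl_eq hN3 hN hP hd1 hd2]
  rw [mem_Icc] at hd1 hd2
  have h1 : (d1 : ℝ) ≠ 0 := by exact_mod_cast (by omega : d1 ≠ 0)
  have h2 : (d2 : ℝ) ≠ 0 := by exact_mod_cast (by omega : d2 ≠ 0)
  have h3 : (Nat.totient d1 : ℝ) ≠ 0 := by exact_mod_cast (Nat.totient_pos.2 (by omega)).ne'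
  have h4 : (Nat.totient d2 : ℝ) ≠ 0 := by exact_mod_cast (Nat.totient_pos.2 (by omega)).ne'
  field_simp

/-- The sum of `χ(d)/d` over `d ≤ D` divisible by all primes in `A`. -/
def chiSum (D : ℝ) (A : Finset Nat.Primes) : ℝ :=
  ∑ d ∈ Icc 1 ⌊D⌋₊, (if ∏ p ∈ A, (p : ℕ) ∣ d then chi4 d / d else 0)

lemma Gam_eq {N : ℕ} (hN3 : 3 ≤ N) (hN : Odd N) {P : Finset Nat.Primes}
    (hP : ∀ p : Nat.Primes, (p : ℕ) ≤ N → p ∈ P) {D : ℝ} (hD0 : 0 < D) (hD : D ≤ N) :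
    Gam N D = S3 N * ∑ A ∈ P.powerset, ∑ B ∈ P.powerset,
      (∏ p ∈ P, locG N p (decide (p ∈ A)) (decide (p ∈ B))) * (chiSum D A * chiSum D B) := by
  have hfilt : (Icc 1 N).filter (fun d : ℕ => (d : ℝ) ≤ D) = Icc 1 ⌊D⌋₊ := by
    ext d
    rw [mem_filter, mem_Icc, mem_Icc, Nat.le_floor_iff hD0.le]
    refine ⟨fun h => ⟨h.1.1, h.2⟩, fun h => ⟨⟨h.1, ?_⟩, h.2⟩⟩
    exact_mod_cast h.2.trans hD
  have hsub : ∀ d ∈ Icc 1 ⌊D⌋₊, d ∈ Icc 1 N := fun d hd => by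
    rw [← hfilt] at hd
    exact (mem_filter.1 hd).1
  have h1 : Gam N D = ∑ d1 ∈ Icc 1 ⌊D⌋₊, ∑ d2 ∈ Icc 1 ⌊D⌋₊,
      chi4 d1 * chi4 d2 / ((Nat.totient d1 : ℝ) * (Nat.totient d2 : ℝ)) * S3kl d1 d2 1 1 N := by
    unfold Gam
    rw [← hfilt, sum_filter]
    refine sum_congr rfl fun d1 _ => ?_
    by_cases h : (d1 : ℝ) ≤ D
    · simp only [h, true_and, if_true, sum_filter]
    · simp [h]
  rw [h1]
  have h2 : ∀ d1 ∈ Icc 1 ⌊D⌋₊, ∀ d2 ∈ Icc 1 ⌊D⌋₊,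
      chi4 d1 * chi4 d2 / ((Nat.totient d1 : ℝ) * (Nat.totient d2 : ℝ)) * S3kl d1 d2 1 1 N =
      S3 N * ∑ x ∈ P.powerset ×ˢ P.powerset,
        (∏ p ∈ P, locG N p (decide (p ∈ x.1)) (decide (p ∈ x.2))) *
          ((if ∏ p ∈ x.1, (p : ℕ) ∣ d1 then chi4 d1 / d1 else 0) *
            (if ∏ p ∈ x.2, (p : ℕ) ∣ d2 then chi4 d2 / d2 else 0)) := by
    intro d1 hd1 d2 hd2
    rw [S3kl_div_totient_eq hN3 hN hP (hsub d1 hd1) (hsub d2 hd2), prod_locH_eq hN,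
      ← sum_product', mul_sum]
    congr 1
    refine sum_congr rfl fun x _ => ?_
    split_ifs <;> ring
  rw [sum_congr rfl fun d1 hd1 => sum_congr rfl fun d2 hd2 => h2 d1 hd1 d2 hd2]
  simp only [← mul_sum]
  congr 1
  rw [← sum_product' (Icc 1 ⌊D⌋₊), ← sum_product' P.powerset, sum_comm]
  refine sum_congr rfl fun x _ => ?_
  rw [← mul_sum, chiSum, chiSum, sum_mul_sum, ← sum_product']

lemma main_term_eq {N : ℕ} (hN3 : 3 ≤ N) (hN : Odd N) (P : Finset Nat.Primes) (z : ℝ) :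
    ∑ A ∈ P.powerset, ∑ B ∈ P.powerset,
      (∏ p ∈ P, locG N p (decide (p ∈ A)) (decide (p ∈ B))) *
        ((chi4 (∏ p ∈ A, (p : ℕ)) / (∏ p ∈ A, (p : ℕ) : ℕ) * z) *
          (chi4 (∏ p ∈ B, (p : ℕ)) / (∏ p ∈ B, (p : ℕ) : ℕ) * z)) =
      z ^ 2 * ∏ p ∈ P, (SRterm1 N p * SRterm2 N p * SRterm3 N p * SRterm4 N p) := by
  rw [prod_congr rfl fun p _ => SRterm_mul_eq p.2 hN3 hN]
  have h := sum_powerset_prod_weights P (fun p i j => locG N p i j)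
    (fun p => chi4 p / p) (fun p => chi4 p / p)
  rw [show ∏ p ∈ P, ((chi4 p / p) * (chi4 p / p) * locG N p true true +
      chi4 p / p * locG N p true false + chi4 p / p * locG N p true false + 1) = _ from h.symm,
    mul_sum]
  refine sum_congr rfl fun A _ => ?_
  rw [mul_sum]
  refine sum_congr rfl fun B _ => ?_
  rw [chi4_prod, chi4_prod, Nat.cast_prod, Nat.cast_prod, ← prod_div_distrib, ← prod_div_distrib]
  ring

lemma abs_mul_sub_mul_le {u u' v v' t t' d : ℝ} (ht : 0 ≤ t) (hd : 0 ≤ d)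
    (h1 : |u - v| ≤ d * t) (h2 : |u - v| ≤ t) (h3 : |u' - v'| ≤ d * t') (hv : |v| ≤ t)
    (hv' : |v'| ≤ t') : |u * u' - v * v'| ≤ 3 * d * (t * t') := by
  have hu : |u| ≤ 2 * t := by
    have := abs_add_le (u - v) v
    rw [sub_add_cancel] at this
    linarith
  calc |u * u' - v * v'| = |u * (u' - v') + (u - v) * v'| := by ring_nf
    _ ≤ |u * (u' - v')| + |(u - v) * v'| := abs_add_le _ _
    _ = |u| * |u' - v'| + |u - v| * |v'| := by rw [abs_mul, abs_mul]
    _ ≤ (2 * t) * (d * t') + (d * t) * t' := by gcongr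
    _ = 3 * d * (t * t') := by ring

lemma sum_abs_locG_le {N : ℕ} (hN3 : 3 ≤ N) (hN : Odd N) (P : Finset Nat.Primes) :
    ∑ A ∈ P.powerset, ∑ B ∈ P.powerset,
      (∏ p ∈ P, |locG N p (decide (p ∈ A)) (decide (p ∈ B))|) *
        (((∏ p ∈ A, (p : ℕ) : ℕ) : ℝ) ^ (-(3 / 4) : ℝ) *
          ((∏ p ∈ B, (p : ℕ) : ℕ) : ℝ) ^ (-(3 / 4) : ℝ)) ≤
      Real.exp (24 * ∑' p : Nat.Primes, (p : ℝ) ^ (-(3 / 2) : ℝ)) := by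
  have h := sum_powerset_prod_weights P (fun p i j => |locG N p i j|)
    (fun p => (p : ℝ) ^ (-(3 / 4) : ℝ)) (fun p => (p : ℝ) ^ (-(3 / 4) : ℝ))
  have hprod : ∀ A : Finset Nat.Primes, ((∏ p ∈ A, (p : ℕ) : ℕ) : ℝ) ^ (-(3 / 4) : ℝ) =
      ∏ p ∈ A, (p : ℝ) ^ (-(3 / 4) : ℝ) := by
    intro A
    rw [Nat.cast_prod, Real.finsetProd_rpow]
    exact fun p _ => Nat.cast_nonneg _
  simp only [hprod]
  rw [h]
  refine prod_primes_le_exp (by norm_num) P (fun p => by positivity) fun p => ?_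
  obtain ⟨b1, b2⟩ := locG_bounds p.2 hN3 hN
  have hp2 := two_le_prime_cast p.2
  have hp1 : (1 : ℝ) ≤ p := by linarith
  have hpos : (0 : ℝ) < p := by linarith
  have e1 : (p : ℝ) ^ (-(3 / 4) : ℝ) * (p : ℝ) ^ (-(3 / 4) : ℝ) = (p : ℝ) ^ (-(3 / 2) : ℝ) := by
    rw [← Real.rpow_add hpos]
    norm_num
  have e2 : (p : ℝ) ^ (-(3 / 4) : ℝ) * |locG N p true false| ≤ 8 * (p : ℝ) ^ (-(3 / 2) : ℝ) := by
    calc (p : ℝ) ^ (-(3 / 4) : ℝ) * |locG N p true false|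
        ≤ (p : ℝ) ^ (-(3 / 4) : ℝ) * (8 / p) := by gcongr
      _ = 8 * (p : ℝ) ^ (-(7 / 4) : ℝ) := by
        rw [show (-(7 / 4) : ℝ) = -(3 / 4) + -1 by norm_num, Real.rpow_add hpos, Real.rpow_neg_one]
        ring
      _ ≤ 8 * (p : ℝ) ^ (-(3 / 2) : ℝ) := by
        exact mul_le_mul_of_nonneg_left
          (Real.rpow_le_rpow_of_exponent_le hp1 (by norm_num)) (by norm_num)
  have e3 : (p : ℝ) ^ (-(3 / 2) : ℝ) * |locG N p true true| ≤ (p : ℝ) ^ (-(3 / 2) : ℝ) * 8 := by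
    gcongr
  have e4 : locG N p false true = locG N p true false := rfl
  have e5 : |locG N p false false| = 1 := by simp [locG]
  rw [e1, e4, e5]
  linarith

lemma error_bound {N : ℕ} (hN3 : 3 ≤ N) (hN : Odd N) {P : Finset Nat.Primes}
    (hP : ∀ p : Nat.Primes, (p : ℕ) ≤ N → p ∈ P) {D : ℝ} (hD0 : 0 < D) (hD : D ≤ N) :
    |Gam N D - S3 N * ((Real.pi / 4) ^ 2 *
        ∏ p ∈ P, (SRterm1 N p * SRterm2 N p * SRterm3 N p * SRterm4 N p))| ≤
      Real.exp (4 * ∑' p : Nat.Primes, (p : ℝ) ^ (-(3 / 2) : ℝ)) *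
        (3 * D ^ (-(1 / 4) : ℝ) *
          Real.exp (24 * ∑' p : Nat.Primes, (p : ℝ) ^ (-(3 / 2) : ℝ))) := by
  rw [Gam_eq hN3 hN hP hD0 hD, ← main_term_eq hN3 hN, ← mul_sub, abs_mul]
  refine mul_le_mul (abs_S3_le hN) ?_ (abs_nonneg _) (Real.exp_pos _).le
  refine le_trans ?_ (mul_le_mul_of_nonneg_left (sum_abs_locG_le hN3 hN P) (by positivity))
  rw [← sum_sub_distrib, mul_sum]
  refine (abs_sum_le_sum_abs _ _).trans (sum_le_sum fun A _ => ?_)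
  rw [← sum_sub_distrib, mul_sum]
  refine (abs_sum_le_sum_abs _ _).trans (sum_le_sum fun B _ => ?_)
  have hpos : ∀ A : Finset Nat.Primes, 0 < ∏ p ∈ A, (p : ℕ) :=
    fun A => prod_pos fun p _ => p.2.pos
  have hV : ∀ A : Finset Nat.Primes,
      |chi4 (∏ p ∈ A, (p : ℕ)) / (∏ p ∈ A, (p : ℕ) : ℕ) * (Real.pi / 4)| ≤
        ((∏ p ∈ A, (p : ℕ) : ℕ) : ℝ) ^ (-(3 / 4) : ℝ) := by
    intro A
    have he : (1 : ℝ) ≤ (∏ p ∈ A, (p : ℕ) : ℕ) := by exact_mod_cast hpos A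
    generalize ∏ p ∈ A, (p : ℕ) = e at he
    have hpi : |Real.pi / 4| ≤ 1 := by
      rw [abs_of_pos (by positivity)]
      linarith [Real.pi_le_four]
    calc |chi4 e / e * (Real.pi / 4)| = |chi4 e| / e * |Real.pi / 4| := by
          rw [abs_mul, abs_div, Nat.abs_cast]
      _ ≤ 1 / e * 1 := by
          gcongr
          exact abs_chi4_le e
      _ = (e : ℝ) ^ (-1 : ℝ) := by rw [Real.rpow_neg_one, mul_one, one_div]
      _ ≤ _ := Real.rpow_le_rpow_of_exponent_le he (by norm_num)
  have hA := abs_sum_chi4_div_of_dvd_sub_le hD0 (hpos A)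
  have hB := abs_sum_chi4_div_of_dvd_sub_le hD0 (hpos B)
  rw [← mul_sub, abs_mul, abs_prod]
  calc _ ≤ (∏ p ∈ P, |locG N p (decide (p ∈ A)) (decide (p ∈ B))|) * _ :=
        mul_le_mul_of_nonneg_left (abs_mul_sub_mul_le (by positivity) (by positivity)
          hA.1 hA.2 hB.1 (hV A) (hV B)) (prod_nonneg fun p _ => abs_nonneg _)
    _ = _ := by ring

lemma finite_primes_le (N : ℕ) : {p : Nat.Primes | (p : ℕ) ≤ N}.Finite :=
  (Set.finite_Iic N).preimage Subtype.val_injective.injOn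

lemma multipliable_of_eq_one_of_lt {f : Nat.Primes → ℝ} (N : ℕ)
    (h : ∀ p : Nat.Primes, N < p → f p = 1) : Multipliable f :=
  multipliable_of_hasFiniteMulSupport ((finite_primes_le N).subset fun p hp =>
    not_lt.1 fun hlt => hp (h p hlt))

lemma multipliable_SRterm1 (N : ℕ) : Multipliable fun p : Nat.Primes => SRterm1 N p := by
  refine multipliable_of_abs_sub_one_le (K := 28) (fun p => ?_) (by norm_num)
  unfold SRterm1
  split_ifs
  · rw [sub_self, abs_zero]
    positivity
  · have h2 := two_le_prime_cast p.2
    have hpos : (0 : ℝ) < p := by linarith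
    have hc := sq_sub_pos (p : ℝ)
    have key : (p : ℝ) ^ 2 ≤ 4 * ((p : ℝ) ^ 2 - 3 * p + 3) := by
      nlinarith [sq_nonneg ((p : ℝ) - 2)]
    have hchi := abs_chi4_le p
    obtain ⟨hc1, hc2⟩ := abs_le.1 hchi
    have hnum : |2 * (p : ℝ) ^ 2 + (p : ℝ) * chi4 p - 6 * (p : ℝ) + 3 * chi4 p| ≤
        7 * (p : ℝ) ^ 2 := by
      rw [abs_le]
      constructor <;> nlinarith
    rw [add_sub_cancel_left, abs_div, abs_mul, abs_of_pos (mul_pos (pow_pos hpos 2) hc),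
      mul_one_div, div_le_div_iff₀ (mul_pos (pow_pos hpos 2) hc) (pow_pos hpos 2)]
    calc |chi4 p| * |2 * (p : ℝ) ^ 2 + (p : ℝ) * chi4 p - 6 * (p : ℝ) + 3 * chi4 p| * (p : ℝ) ^ 2
        ≤ 1 * (7 * (p : ℝ) ^ 2) * (p : ℝ) ^ 2 := by gcongr
      _ ≤ 1 * (7 * (p : ℝ) ^ 2) * (4 * ((p : ℝ) ^ 2 - 3 * p + 3)) := by gcongr
      _ = 28 * ((p : ℝ) ^ 2 * ((p : ℝ) ^ 2 - 3 * p + 3)) := by ring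

lemma tendsto_prod_SRterm {N : ℕ} (hN3 : 3 ≤ N) :
    Filter.Tendsto (fun P : Finset Nat.Primes => S3 N * ((Real.pi / 4) ^ 2 *
        ∏ p ∈ P, (SRterm1 N p * SRterm2 N p * SRterm3 N p * SRterm4 N p))) Filter.atTop
      (nhds ((1 / 16) * SR N)) := by
  have h1 := multipliable_SRterm1 N
  have h2 : Multipliable fun p : Nat.Primes => SRterm2 N p :=
    multipliable_of_eq_one_of_lt N fun p hp =>
      if_neg fun h => absurd (Nat.le_of_dvd (by omega) h) (by omega)
  have h3 : Multipliable fun p : Nat.Primes => SRterm3 N p :=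
    multipliable_of_eq_one_of_lt N fun p hp =>
      if_neg fun h => absurd (Nat.le_of_dvd (by omega) h) (by omega)
  have h4 : Multipliable fun p : Nat.Primes => SRterm4 N p :=
    multipliable_of_eq_one_of_lt N fun p hp =>
      if_neg fun h => absurd (Nat.le_of_dvd (by omega) h) (by omega)
  have h : Filter.Tendsto (fun P : Finset Nat.Primes =>
      ∏ p ∈ P, (SRterm1 N p * SRterm2 N p * SRterm3 N p * SRterm4 N p)) Filter.atTop
      (nhds ((∏' p : Nat.Primes, SRterm1 N p) * (∏' p : Nat.Primes, SRterm2 N p) *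
        (∏' p : Nat.Primes, SRterm3 N p) * (∏' p : Nat.Primes, SRterm4 N p))) :=
    ((h1.hasProd.mul h2.hasProd).mul h3.hasProd).mul h4.hasProd
  convert (h.const_mul ((Real.pi / 4) ^ 2)).const_mul (S3 N) using 2
  rw [SR]
  ring

lemma abs_Gam_sub_SR_le {N : ℕ} (hN3 : 3 ≤ N) (hN : Odd N) {D : ℝ} (hD0 : 0 < D) (hD : D ≤ N) :
    |Gam N D - (1 / 16) * SR N| ≤
      Real.exp (4 * ∑' p : Nat.Primes, (p : ℝ) ^ (-(3 / 2) : ℝ)) *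
        (3 * D ^ (-(1 / 4) : ℝ) *
          Real.exp (24 * ∑' p : Nat.Primes, (p : ℝ) ^ (-(3 / 2) : ℝ))) := by
  refine le_of_tendsto ((tendsto_prod_SRterm hN3).const_sub (Gam N D)).abs ?_
  filter_upwards [Filter.eventually_ge_atTop (finite_primes_le N).toFinset] with P hP
  exact error_bound hN3 hN (fun p hp => hP ((finite_primes_le N).mem_toFinset.2 hp)) hD0 hD

lemma eventually_log_rpow_le (c : ℝ) :
    ∃ N0 : ℕ, ∀ N : ℕ, N0 ≤ N → Real.log N ^ (c / 4) ≤ (N : ℝ) ^ (1 / 10 : ℝ) := by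
  have h := (isLittleO_log_rpow_rpow_atTop (s := 1 / 10) (c / 4) (by norm_num)).bound one_pos
  have h' := (tendsto_natCast_atTop_atTop (R := ℝ)).eventually h
  obtain ⟨N0, hN0⟩ := Filter.eventually_atTop.1 h'
  refine ⟨N0, fun N hN => ?_⟩
  have := hN0 N hN
  rw [one_mul, Real.norm_of_nonneg (by positivity : (0 : ℝ) ≤ (N : ℝ) ^ (1 / 10 : ℝ))] at this
  exact (Real.le_norm_self _).trans this

/-- with D = √N (log N)^{-c},
Γ(N) = (1/16) 𝔖_R(N) + O(N^{ε - 1/100}) for large odd N. -/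
theorem Gamma_asymptotic :
    ∀ c : ℝ, 0 < c → ∀ ε : ℝ, 0 < ε → ∃ C : ℝ, 0 < C ∧ ∃ N0 : ℕ,
      ∀ N : ℕ, N0 ≤ N → Odd N →
        |Gam N (Real.sqrt N * Real.log N ^ (-c)) - (1 / 16) * SR N| ≤
          C * (N : ℝ) ^ (ε - 1 / 100) := by
  intro c hc ε hε
  obtain ⟨N0, hN0⟩ := eventually_log_rpow_le c
  refine ⟨Real.exp (4 * ∑' p : Nat.Primes, (p : ℝ) ^ (-(3 / 2) : ℝ)) *
    (3 * Real.exp (24 * ∑' p : Nat.Primes, (p : ℝ) ^ (-(3 / 2) : ℝ))), by positivity,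
    max N0 3, fun N hNN hN => ?_⟩
  have hN3 : 3 ≤ N := (le_max_right _ _).trans hNN
  have hNr : (3 : ℝ) ≤ N := by exact_mod_cast hN3
  have hN1 : (1 : ℝ) ≤ N := by linarith
  have hNpos : (0 : ℝ) < N := by linarith
  have hlog : 1 ≤ Real.log N := by
    rw [Real.le_log_iff_exp_le hNpos]
    linarith [Real.exp_one_lt_d9]
  have hlog0 : 0 < Real.log N := by linarith
  set D := Real.sqrt N * Real.log N ^ (-c) with hDdef
  have hD0 : 0 < D := by positivity
  have hD : D ≤ N := by
    have h1 : Real.log N ^ (-c) ≤ 1 := Real.rpow_le_one_of_one_le_of_nonpos hlog (by linarith)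
    have h2 : Real.sqrt N ≤ N := Real.sqrt_le_iff.2 ⟨hNpos.le, by nlinarith⟩
    calc D ≤ Real.sqrt N * 1 := mul_le_mul_of_nonneg_left h1 (Real.sqrt_nonneg _)
      _ ≤ N := by linarith
  have hDpow : D ^ (-(1 / 4) : ℝ) ≤ (N : ℝ) ^ (ε - 1 / 100) := by
    calc D ^ (-(1 / 4) : ℝ) = (N : ℝ) ^ (-(1 / 8) : ℝ) * Real.log N ^ (c / 4) := by
          rw [hDdef, Real.mul_rpow (by positivity) (by positivity), Real.sqrt_eq_rpow,
            ← Real.rpow_mul hNpos.le, ← Real.rpow_mul hlog0.le]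
          congr 2 <;> ring
      _ ≤ (N : ℝ) ^ (-(1 / 8) : ℝ) * (N : ℝ) ^ (1 / 10 : ℝ) := by
          gcongr
          exact hN0 N ((le_max_left _ _).trans hNN)
      _ = (N : ℝ) ^ (-(1 / 40) : ℝ) := by
          rw [← Real.rpow_add hNpos]
          norm_num
      _ ≤ _ := Real.rpow_le_rpow_of_exponent_le hN1 (by linarith)
  refine (abs_Gam_sub_SR_le hN3 hN hD0 hD).trans ?_
  calc _ = Real.exp (4 * ∑' p : Nat.Primes, (p : ℝ) ^ (-(3 / 2) : ℝ)) *
        (3 * Real.exp (24 * ∑' p : Nat.Primes, (p : ℝ) ^ (-(3 / 2) : ℝ))) *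
          D ^ (-(1 / 4) : ℝ) := by ring
    _ ≤ _ := by gcongr
end
end
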